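/- arXiv:1411.7116 — 3 statements merged into one kernel-verified Lean document; each statement's English description precedes it below -/
import Mathlib

section
/- Let ρ = (ρ_1,…,ρ_m) and τ = (τ_1,…,τ_n) have all entries in (0,1), with m, n ≥ 2, and suppose both ρ and τ are coplanar. Let E ⊆ ℝ^d and F ⊆ ℝ^{d'} be dust-like self-similar sets with contraction vectors ρ and τ respectively. Then E and F are Lipschitz equivalent if and only if there exist positive integers p and q such that the p-th iteration of ρ equals the q-th iteration of τ as multisets. -/
set_option linter.unusedSimpArgs false
open scoped BigOperators

noncomputable section

/-- `E ⊆ ℝ^d` is a dust-like self-similar set with contraction vector `ρ`: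
`E` is nonempty compact, each `ρ j ∈ (0,1)`, and there are similarities `φ j`
with ratios `ρ j` such that `E = ⋃ j, φ j '' E` is a disjoint union. -/
def IsDustLike {d : ℕ} {ι : Type} [Fintype ι]
    (E : Set (EuclideanSpace ℝ (Fin d))) (ρ : ι → ℝ) : Prop :=
  IsCompact E ∧ E.Nonempty ∧ (∀ j, ρ j ∈ Set.Ioo (0 : ℝ) 1) ∧
  ∃ φ : ι → EuclideanSpace ℝ (Fin d) → EuclideanSpace ℝ (Fin d),
    (∀ j x y, dist (φ j x) (φ j y) = ρ j * dist x y) ∧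
    E = ⋃ j, φ j '' E ∧
    Pairwise fun j k => Disjoint (φ j '' E) (φ k '' E)

/-- `E` and `F` are Lipschitz equivalent: there is a bi-Lipschitz bijection between them. -/
def LipEquiv {d d' : ℕ} (E : Set (EuclideanSpace ℝ (Fin d)))
    (F : Set (EuclideanSpace ℝ (Fin d'))) : Prop :=
  ∃ f : E → F, Function.Bijective f ∧ ∃ C : ℝ, 0 < C ∧ ∀ x y : E,
    C⁻¹ * dist (x : EuclideanSpace ℝ (Fin d)) (y : EuclideanSpace ℝ (Fin d))
      ≤ dist (f x : EuclideanSpace ℝ (Fin d')) (f y : EuclideanSpace ℝ (Fin d')) ∧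
    dist (f x : EuclideanSpace ℝ (Fin d')) (f y : EuclideanSpace ℝ (Fin d'))
      ≤ C * dist (x : EuclideanSpace ℝ (Fin d)) (y : EuclideanSpace ℝ (Fin d))

/-- `λ = (λ_1,…,λ_s)` is a pseudo-basis of `ρ = (ρ_1,…,ρ_m)` with integer
logarithms `X_j = log_λ ρ_j`: the `λ_i` are positive with `log λ_i` linearly
independent over `ℚ`, each `ρ_j = ∏ i, λ_i ^ X_{j,i}`, and the `ℚ`-span of the
`log ρ_j` has dimension `s`. -/
def IsPseudoBasis {s m : ℕ} (lam : Fin s → ℝ) (ρ : Fin m → ℝ)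
    (X : Fin m → Fin s → ℤ) : Prop :=
  (∀ i, 0 < lam i) ∧
  (LinearIndependent ℚ fun i => Real.log (lam i)) ∧
  (∀ j, ρ j = ∏ i, lam i ^ X j i) ∧
  Module.finrank ℚ (Submodule.span ℚ (Set.range fun j => Real.log (ρ j))) = s

/-- `ρ` is coplanar: it has a pseudo-basis `λ` such that the vectors
`X_j = log_λ ρ_j` lie on a common affine hyperplane `η · x = 1`. -/
def IsCoplanar {m : ℕ} (ρ : Fin m → ℝ) : Prop :=
  ∃ s : ℕ, ∃ lam : Fin s → ℝ, ∃ X : Fin m → Fin s → ℤ,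
    IsPseudoBasis lam ρ X ∧ ∃ η : Fin s → ℝ, ∀ j, (∑ i, η i * (X j i : ℝ)) = 1

/-- The `p`-th iteration of `ρ = (ρ_1,…,ρ_m)` as a multiset:
`{ ρ_{i_1}·…·ρ_{i_p} : (i_1,…,i_p) ∈ {1,…,m}^p }` with multiplicities counted. -/
def iterMS {m : ℕ} (ρ : Fin m → ℝ) (p : ℕ) : Multiset ℝ :=
  Finset.univ.val.map fun f : Fin p → Fin m => ∏ t, ρ (f t)


theorem alg_root {ι κ : Type} [Fintype ι] [Fintype κ] (α : κ → ℕ) (β : ι → ℕ) (D L : ℕ)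
    (hD : 0 < D) (hL : 0 < L) (hβ : ∃ j, β j = L) (hβ' : ∀ j, β j ≤ L)
    (H : ∀ x : ℝ, 0 < x → ∃ z : ℝ, z ^ D = ∑ k, x ^ α k ∧ z ^ L = x ^ D * ∑ j, z ^ (L - β j))
    (z : ℂ) (hz : ∑ k, z ^ α k = 0) : z = 0 := by
  classical
  open Polynomial in
  let p : ℂ[X] := ∑ k, X ^ α k
  let f : ℂ[X][X] := X ^ D - C p
  let g : ℂ[X][X] := X ^ L - C (X ^ D) * ∑ j, X ^ (L - β j)
  let N := g.natDegree
  have hfd : f.natDegree ≤ D := by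
    simp only [f]; compute_degree!
  let r := resultant f g D N
  have hr : r = 0 := by
    apply Polynomial.eq_zero_of_infinite_isRoot
    have : Set.Infinite ((fun x : ℝ => (x : ℂ)) '' Set.Ioi 0) :=
      (Set.Ioi_infinite 0).image (Complex.ofReal_injective.injOn)
    refine this.mono ?_
    rintro _ ⟨x, hx, rfl⟩
    obtain ⟨w, h1, h2⟩ := H x hx
    obtain ⟨a, b, -, -, hab⟩ := exists_mul_add_mul_eq_C_resultant f g hfd le_rfl (Or.inl hD.ne')
    have h3 := congrArg (fun q => eval₂ (evalRingHom (x:ℂ)) (w:ℂ) q) hab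
    simp only [eval₂_add, eval₂_mul, eval₂_C] at h3
    have hf0 : eval₂ (evalRingHom (x:ℂ)) (w:ℂ) f = 0 := by
      simp only [f, p, eval₂_sub, eval₂_pow, eval₂_X, eval₂_C, coe_evalRingHom, eval_finsetSum, eval_pow, eval_X]
      rw [sub_eq_zero]; exact_mod_cast h1
    have hg0 : eval₂ (evalRingHom (x:ℂ)) (w:ℂ) g = 0 := by
      simp only [g, eval₂_sub, eval₂_mul, eval₂_finsetSum, eval₂_pow, eval₂_X, eval₂_C, coe_evalRingHom, eval_pow, eval_X]
      rw [sub_eq_zero]; exact_mod_cast h2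
    rw [hf0, hg0] at h3
    simpa [IsRoot, r] using h3.symm
  have h4 : evalRingHom z r = 0 := by rw [hr]; simp
  rw [show r = resultant f g D N from rfl, ← resultant_map_map] at h4
  have hfz : f.map (evalRingHom z) = X ^ D := by
    have hpz : p.eval z = 0 := by simpa [p, eval_finsetSum] using hz
    simp only [f, Polynomial.map_sub, Polynomial.map_pow, map_X, map_C, coe_evalRingHom, hpz, C_0, sub_zero]
  rw [hfz, resultant_X_pow_left _ _ _ (natDegree_map_le)] at h4
  have h5 := eq_zero_of_pow_eq_zero h4
  have h6 : (∑ j, (0:ℂ) ^ (L - β j)) ≠ 0 := by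
    have : (∑ j, (0:ℂ) ^ (L - β j)) = ((Finset.univ.filter (fun j => β j = L)).card : ℂ) := by
      rw [Finset.card_eq_sum_ones, Finset.sum_filter]
      push_cast
      refine Finset.sum_congr rfl fun j _ => ?_
      have := hβ' j
      split_ifs with h
      · simp [h]
      · rw [zero_pow (by omega)]
    rw [this]
    obtain ⟨j, hj⟩ := hβ
    have : 0 < (Finset.univ.filter (fun j => β j = L)).card := Finset.card_pos.2 ⟨j, by simp [hj]⟩
    exact_mod_cast this.ne'
  rw [coeff_zero_eq_eval_zero] at h5
  simp only [g, Polynomial.map_sub, Polynomial.map_mul, Polynomial.map_pow, map_X, map_C, Polynomial.map_sum, eval_sub, eval_mul, eval_pow, eval_X, eval_C, eval_finsetSum, coe_evalRingHom, zero_pow hL.ne', zero_sub, neg_eq_zero, mul_eq_zero] at h5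
  exact eq_zero_of_pow_eq_zero (h5.resolve_right h6)

theorem alg_const {ι κ : Type} [Fintype ι] [Fintype κ] (α : κ → ℕ) (β : ι → ℕ) (D L : ℕ)
    (hD : 0 < D) (hL : 0 < L) (hβ : ∃ j, β j = L) (hβ' : ∀ j, β j ≤ L)
    (H : ∀ x : ℝ, 0 < x → ∃ z : ℝ, z ^ D = ∑ k, x ^ α k ∧ z ^ L = x ^ D * ∑ j, z ^ (L - β j)) :
    ∃ N, ∀ k, α k = N := by
  classical
  open Polynomial in
  rcases isEmpty_or_nonempty κ with h | ⟨⟨k0⟩⟩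
  · exact ⟨0, fun k => h.elim k⟩
  let p : ℂ[X] := ∑ k, X ^ α k
  have hc : ∀ k, p.coeff (α k) ≠ 0 := by
    intro k
    have : p.coeff (α k) = ((Finset.univ.filter (fun j => α k = α j)).card : ℂ) := by
      simp only [p, finsetSum_coeff, coeff_X_pow, Finset.sum_boole]
    rw [this]
    have : 0 < (Finset.univ.filter (fun j => α k = α j)).card := Finset.card_pos.2 ⟨k, by simp⟩
    exact_mod_cast this.ne'
  have hp : p ≠ 0 := fun h => hc k0 (by rw [h]; simp)
  obtain ⟨q, hq, hnd⟩ := exists_eq_pow_rootMultiplicity_mul_and_not_dvd p hp 0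
  set N := rootMultiplicity 0 p
  have hdeg : q.degree = 0 := by
    by_contra hne
    obtain ⟨z, hz⟩ := Complex.exists_root (f := q) (by
      refine lt_of_le_of_ne ?_ (Ne.symm hne)
      rw [zero_le_degree_iff]
      rintro rfl; simp at hnd)
    have : p.eval z = 0 := by rw [hq, eval_mul, hz.eq_zero, mul_zero]
    have hz0 := alg_root α β D L hD hL hβ hβ' H z (by simpa [p, eval_finsetSum] using this)
    subst hz0
    exact hnd (dvd_iff_isRoot.2 hz)
  rw [eq_C_of_degree_eq_zero hdeg] at hq
  refine ⟨N, fun k => ?_⟩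
  by_contra hne
  apply hc k
  rw [hq, C_0, sub_zero, coeff_mul_C, coeff_X_pow, if_neg hne, zero_mul]


def wt {ι : Type} (ρ : ι → ℝ) (k : List ι) : ℝ := (k.map ρ).prod

theorem wt_append {ι : Type} (ρ : ι → ℝ) (k l : List ι) : wt ρ (k ++ l) = wt ρ k * wt ρ l := by
  simp [wt]

theorem wt_pos {ι : Type} {ρ : ι → ℝ} (h : ∀ i, 0 < ρ i) (k : List ι) : 0 < wt ρ k := by
  induction k with
  | nil => simp [wt]
  | cons a k ih => simpa [wt] using mul_pos (h a) ih

theorem wt_le_pow {ι : Type} {ρ : ι → ℝ} (h : ∀ i, 0 < ρ i) {c : ℝ} (hc : ∀ i, ρ i ≤ c) (k : List ι) :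
    wt ρ k ≤ c ^ k.length := by
  induction k with
  | nil => simp [wt]
  | cons a k ih =>
    have : wt ρ (a :: k) = ρ a * wt ρ k := by simp [wt]
    rw [this, List.length_cons, pow_succ']
    exact mul_le_mul (hc a) ih (wt_pos h k).le ((h a).le.trans (hc a))

theorem wt_le_one {ι : Type} {ρ : ι → ℝ} (h : ∀ i, 0 < ρ i) (hc : ∀ i, ρ i < 1) (k : List ι) :
    wt ρ k ≤ 1 := by
  simpa using wt_le_pow h (fun i => (hc i).le) k

theorem summable_wt {ι : Type} [Fintype ι] {c : ι → ℝ} (hc : ∀ i, 0 < c i) :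
    Summable (fun k : List ι => wt c k) ↔ ∑ i, c i < 1 := by
  rw [← (List.equivSigmaTuple (α := ι)).symm.summable_iff, summable_sigma_of_nonneg]
  · have h1 : ∀ n, (∑' y : Fin n → ι, ((fun k : List ι => wt c k) ∘ (List.equivSigmaTuple (α := ι)).symm) ⟨n, y⟩)
        = (∑ i, c i) ^ n := by
      intro n
      rw [tsum_fintype, Fintype.sum_pow]
      refine Finset.sum_congr rfl fun y _ => ?_
      simp [List.equivSigmaTuple, wt, List.map_ofFn, List.prod_ofFn]
    simp only [h1]
    rw [summable_geometric_iff_norm_lt_one, Real.norm_of_nonneg (Finset.sum_nonneg fun i _ => (hc i).le)]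
    exact ⟨fun h => h.2, fun h => ⟨fun n => (hasSum_fintype _).summable, h⟩⟩
  · intro x; exact (wt_pos hc _).le

/-- conclusion of the geometric part -/
def Embeds {ι κ : Type} (ρ : ι → ℝ) (τ : κ → ℝ) : Prop :=
  ∃ (A : Type) (_ : Finite A) (β : A → ℝ) (Φ : List ι → List κ × A), Function.Injective Φ ∧
    ∀ k, wt ρ k = β (Φ k).2 * wt τ (Φ k).1

theorem log_wt {ι : Type} {ρ : ι → ℝ} (h : ∀ i, 0 < ρ i) (θ : ℝ →ₗ[ℚ] ℝ) (k : List ι) :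
    Real.exp (θ (Real.log (wt ρ k))) = wt (fun i => Real.exp (θ (Real.log (ρ i)))) k := by
  induction k with
  | nil => simp [wt]
  | cons a k ih =>
    have : wt ρ (a :: k) = ρ a * wt ρ k := by simp [wt]
    rw [this, Real.log_mul (h a).ne' (wt_pos h k).ne', map_add, Real.exp_add, ih]
    simp [wt]

def PP {ι : Type} [Fintype ι] (ρ : ι → ℝ) (θ : ℝ →ₗ[ℚ] ℝ) : ℝ := ∑ i, Real.exp (θ (Real.log (ρ i)))

theorem Embeds.lt_one {ι κ : Type} [Fintype ι] [Fintype κ] {ρ : ι → ℝ} {τ : κ → ℝ}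
    (hρ : ∀ i, 0 < ρ i) (hτ : ∀ i, 0 < τ i) (h : Embeds ρ τ) (θ : ℝ →ₗ[ℚ] ℝ)
    (h1 : PP τ θ < 1) : PP ρ θ < 1 := by
  obtain ⟨A, hA, β, Φ, hinj, hΦ⟩ := h
  have := Fintype.ofFinite A
  rw [PP, ← summable_wt (fun i => Real.exp_pos _)] at h1 ⊢
  have h2 : Summable (fun p : List κ × A => wt (fun i => Real.exp (θ (Real.log (τ i)))) p.1 *
      Real.exp (θ (Real.log (β p.2)))) :=
    h1.mul_of_nonneg (g := fun a : A => Real.exp (θ (Real.log (β a)))) (hasSum_fintype _).summable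
      (fun k => (wt_pos (fun i => Real.exp_pos _) k).le) (fun a => (Real.exp_pos _).le)
  refine (h2.comp_injective hinj).congr fun k => ?_
  have h3 := hΦ k
  have h4 := wt_pos hρ k
  have h5 := wt_pos hτ (Φ k).1
  have hb : β (Φ k).2 ≠ 0 := by
    intro h0; rw [h0, zero_mul] at h3; exact h4.ne' h3
  simp only [Function.comp]
  rw [← log_wt hρ, ← log_wt hτ, h3, Real.log_mul hb h5.ne', map_add, Real.exp_add, mul_comm]

theorem eta_wt {ι : Type} {ρ : ι → ℝ} (h : ∀ i, 0 < ρ i) (η : ℝ →ₗ[ℚ] ℝ)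
    (h1 : ∀ i, η (Real.log (ρ i)) = 1) (k : List ι) : η (Real.log (wt ρ k)) = k.length := by
  induction k with
  | nil => simp [wt]
  | cons a k ih =>
    have : wt ρ (a :: k) = ρ a * wt ρ k := by simp [wt]
    rw [this, Real.log_mul (h a).ne' (wt_pos h k).ne', map_add, ih, h1]
    simp [add_comm]

theorem Embeds.rat {ι κ : Type} [Fintype ι] [Fintype κ] {ρ : ι → ℝ} {τ : κ → ℝ}
    (hρ : ∀ i, 0 < ρ i) (hτ : ∀ i, 0 < τ i) (h : Embeds ρ τ) (η : ℝ →ₗ[ℚ] ℝ)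
    (h1 : ∀ k, η (Real.log (τ k)) = 1) (i : ι) :
    ∃ u v : ℕ, 0 < u ∧ 0 < v ∧ (v : ℝ) * η (Real.log (ρ i)) = u := by
  obtain ⟨A, hA, β, Φ, hinj, hΦ⟩ := h
  obtain ⟨a, ha⟩ := Finite.exists_infinite_fiber (fun r : ℕ => (Φ (List.replicate r i)).2)
  set S : Set ℕ := (fun r : ℕ => (Φ (List.replicate r i)).2) ⁻¹' {a} with hS
  have hSinf : S.Infinite := Set.infinite_coe_iff.1 ha
  obtain ⟨r0, hr0⟩ := hSinf.nonempty
  have hS' : (S \ Set.Iic r0).Infinite := hSinf.sdiff (Set.finite_Iic r0)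
  have hex : ∃ r ∈ S \ Set.Iic r0, (Φ (List.replicate r0 i)).1.length < (Φ (List.replicate r i)).1.length := by
    by_contra hcon
    push Not at hcon
    have hinj2 : Set.InjOn (fun r : ℕ => (Φ (List.replicate r i)).1) (S \ Set.Iic r0) := by
      intro x hx y hy hxy
      have : Φ (List.replicate x i) = Φ (List.replicate y i) := by
        refine Prod.ext hxy ?_
        have e1 := hx.1; have e2 := hy.1
        simp only [hS, Set.mem_preimage, Set.mem_singleton_iff] at e1 e2
        rw [e1, e2]
      have := congrArg List.length (hinj this)
      simpa using this
    refine hS' (Set.Finite.of_finite_image ((List.finite_length_le κ ((Φ (List.replicate r0 i)).1.length)).subset ?_) hinj2)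
    rintro _ ⟨r, hr, rfl⟩
    exact hcon r hr
  obtain ⟨r, ⟨hrS, hr⟩, hlen⟩ := hex
  have key : ∀ r ∈ S, (r : ℝ) * η (Real.log (ρ i)) = η (Real.log (β a)) + (Φ (List.replicate r i)).1.length := by
    intro r hr
    have h3 := hΦ (List.replicate r i)
    have hra : (Φ (List.replicate r i)).2 = a := hr
    rw [hra] at h3
    have h4 := wt_pos hρ (List.replicate r i)
    have h5 := wt_pos hτ (Φ (List.replicate r i)).1
    have hb : β a ≠ 0 := by
      intro h0; rw [h0, zero_mul] at h3; exact h4.ne' h3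
    rw [← eta_wt hτ η h1, ← map_add, ← Real.log_mul hb h5.ne', ← h3]
    simp only [wt, List.map_replicate, List.prod_replicate, Real.log_pow]
    rw [← nsmul_eq_mul, ← nsmul_eq_mul, map_nsmul]
  have k1 := key r hrS
  have k2 := key r0 hr0
  have hr' : r0 < r := by simpa using hr
  refine ⟨(Φ (List.replicate r i)).1.length - (Φ (List.replicate r0 i)).1.length, r - r0, by omega, by omega, ?_⟩
  rw [Nat.cast_sub hr'.le, Nat.cast_sub hlen.le]
  linarith


theorem PP_add_smul {ι : Type} [Fintype ι] {ρ : ι → ℝ} (θ η : ℝ →ₗ[ℚ] ℝ) (a : ℝ)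
    (h : ∀ i, η (Real.log (ρ i)) = a) (t : ℝ) : PP ρ (θ + t • η) = Real.exp (t * a) * PP ρ θ := by
  simp only [PP, Finset.mul_sum]
  refine Finset.sum_congr rfl fun i _ => ?_
  rw [← Real.exp_add]
  simp [h, add_comm]

theorem ms_eq (s t : Multiset ℝ) (h : ∀ r : ℕ, (s.map (fun x => x ^ r)).sum = (t.map (fun x => x ^ r)).sum) :
    s = t := by
  classical
  have hli := (linearIndependent_monoidHom (Multiplicative ℕ) ℝ).comp (fun x : ℝ => powersHom ℝ x)
    (powersHom ℝ).injective
  rw [linearIndependent_iff'] at hli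
  ext x
  by_contra hne
  have hx : x ∈ (s + t).toFinset := by
    rw [Multiset.mem_toFinset, Multiset.mem_add]
    by_contra hcon
    push Not at hcon
    rw [Multiset.count_eq_zero_of_notMem hcon.1, Multiset.count_eq_zero_of_notMem hcon.2] at hne
    exact hne rfl
  have key := hli (s + t).toFinset (fun x => (s.count x : ℝ) - t.count x) (by
    ext r
    obtain ⟨r, rfl⟩ := Multiplicative.ofAdd.surjective r
    have h1 := h r
    rw [Finset.sum_multiset_map_count, Finset.sum_multiset_map_count] at h1
    rw [Finset.sum_subset (s₂ := (s + t).toFinset) (by simp) (by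
        intro y _ hy; rw [Multiset.count_eq_zero_of_notMem (by simpa using hy)]; simp),
      Finset.sum_subset (s₁ := t.toFinset) (s₂ := (s + t).toFinset) (by simp) (by
        intro y _ hy; rw [Multiset.count_eq_zero_of_notMem (by simpa using hy)]; simp)] at h1
    simp only [Finset.sum_apply, Pi.smul_apply, Function.comp, powersHom_apply, smul_eq_mul, toAdd_ofAdd,
      sub_mul, Finset.sum_sub_distrib, Pi.zero_apply]
    simp only [nsmul_eq_mul] at h1
    rw [h1, sub_self]) x hx
  apply hne
  have : (s.count x : ℝ) = t.count x := by simpa [sub_eq_zero] using key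
  exact_mod_cast this

theorem iterMS_sum {m : ℕ} (ρ : Fin m → ℝ) (p r : ℕ) :
    ((iterMS ρ p).map (fun x => x ^ r)).sum = (∑ j, ρ j ^ r) ^ p := by
  rw [iterMS, Multiset.map_map, Fintype.sum_pow]
  simp only [Function.comp, Finset.prod_pow]
  rfl

theorem common_den {ι : Type} [Fintype ι] (b : ι → ℝ)
    (h : ∀ i, ∃ u v : ℕ, 0 < u ∧ 0 < v ∧ (v : ℝ) * b i = u) :
    ∃ D : ℕ, 0 < D ∧ ∀ i, ∃ n : ℕ, 0 < n ∧ (D : ℝ) * b i = n := by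
  classical
  choose u v hu hv huv using h
  refine ⟨∏ i, v i, Finset.prod_pos fun i _ => hv i, fun i => ⟨(∏ j ∈ Finset.univ.erase i, v j) * u i,
    Nat.mul_pos (Finset.prod_pos fun i _ => hv i) (hu i), ?_⟩⟩
  rw [← Finset.prod_erase_mul _ _ (Finset.mem_univ i)]
  push_cast
  rw [mul_assoc, huv]

theorem PP_eq_one {ι κ : Type} [Fintype ι] [Fintype κ] [Nonempty ι] {ρ : ι → ℝ} {τ : κ → ℝ}
    (hlt : ∀ θ, PP ρ θ < 1 ↔ PP τ θ < 1) (η : ℝ →ₗ[ℚ] ℝ) (h1 : ∀ k, η (Real.log (τ k)) = 1)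
    (hb : ∀ i, 0 < η (Real.log (ρ i))) (θ : ℝ →ₗ[ℚ] ℝ) (h : PP ρ θ = 1) : PP τ θ = 1 := by
  rcases lt_trichotomy (PP τ θ) 1 with h2 | h2 | h2
  · exact absurd ((hlt θ).2 h2) (by rw [h]; exact lt_irrefl _)
  · exact h2
  · exfalso
    set t := Real.log (PP τ θ) with ht
    have htpos : 0 < t := Real.log_pos h2
    have h3 : PP ρ (θ + (-t) • η) < 1 := by
      rw [← h]
      refine Finset.sum_lt_sum_of_nonempty Finset.univ_nonempty fun i _ => ?_
      apply Real.exp_lt_exp.2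
      have := mul_pos htpos (hb i)
      simp only [LinearMap.add_apply, LinearMap.smul_apply, smul_eq_mul]
      linarith
    rw [hlt, PP_add_smul θ η 1 h1, mul_one, Real.exp_neg, ht, Real.exp_log (by linarith),
      inv_mul_cancel₀ (by linarith)] at h3
    exact lt_irrefl _ h3

theorem analysis_main {m n : ℕ} (hm : 2 ≤ m) (hn : 2 ≤ n) (ρ : Fin m → ℝ) (τ : Fin n → ℝ)
    (hρ : ∀ i, 0 < ρ i) (hτ : ∀ k, 0 < τ k) (η ξ : ℝ →ₗ[ℚ] ℝ)
    (hη : ∀ i, η (Real.log (ρ i)) = 1) (hξ : ∀ k, ξ (Real.log (τ k)) = 1)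
    (h1 : Embeds ρ τ) (h2 : Embeds τ ρ) :
    ∃ p q : ℕ, 0 < p ∧ 0 < q ∧ iterMS ρ p = iterMS τ q := by
  haveI : Nonempty (Fin m) := ⟨⟨0, by omega⟩⟩
  haveI : Nonempty (Fin n) := ⟨⟨0, by omega⟩⟩
  have hlt : ∀ θ, PP ρ θ < 1 ↔ PP τ θ < 1 := fun θ =>
    ⟨h2.lt_one hτ hρ θ, h1.lt_one hρ hτ θ⟩
  have hlt' : ∀ θ, PP τ θ < 1 ↔ PP ρ θ < 1 := fun θ => (hlt θ).symm
  have hb := h1.rat hρ hτ ξ hξ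
  have ha := h2.rat hτ hρ η hη
  have hbpos : ∀ i, 0 < ξ (Real.log (ρ i)) := by
    intro i
    obtain ⟨u, v, hu, hv, huv⟩ := hb i
    have hu' : (0:ℝ) < u := by exact_mod_cast hu
    have hv' : (0:ℝ) < v := by exact_mod_cast hv
    by_contra hcon
    push Not at hcon
    nlinarith
  have hapos : ∀ i, 0 < η (Real.log (τ i)) := by
    intro i
    obtain ⟨u, v, hu, hv, huv⟩ := ha i
    have hu' : (0:ℝ) < u := by exact_mod_cast hu
    have hv' : (0:ℝ) < v := by exact_mod_cast hv
    by_contra hcon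
    push Not at hcon
    nlinarith
  have heq1 := fun θ => PP_eq_one hlt ξ hξ hbpos θ
  have heq2 := fun θ => PP_eq_one hlt' η hη hapos θ
  obtain ⟨D, hD, hDD⟩ := common_den (Sum.elim (fun i => ξ (Real.log (ρ i))) (fun k => η (Real.log (τ k))))
    (by rintro (i | k); exacts [hb i, ha k])
  have hD' : (0:ℝ) < D := by exact_mod_cast hD
  choose α hαpos hα using fun k => hDD (Sum.inr k)
  choose β hβpos hβ using fun i => hDD (Sum.inl i)
  simp only [Sum.elim_inr, Sum.elim_inl] at hα hβ
  obtain ⟨j0, hj0⟩ := Finite.exists_max β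
  obtain ⟨N, hN⟩ := alg_const α β D (β j0) hD (hβpos j0) ⟨j0, rfl⟩ hj0 (by
    intro X hX
    set A := ∑ k, X ^ α k with hA
    have hApos : 0 < A := Finset.sum_pos (fun k _ => pow_pos hX _) Finset.univ_nonempty
    set y := - Real.log A with hy
    set x := D * Real.log X with hx
    set Z := Real.exp (-y / D) with hZ
    have hZpos : 0 < Z := Real.exp_pos _
    have hZD : Z ^ D = A := by
      rw [hZ, ← Real.exp_nat_mul, mul_div_cancel₀ _ hD'.ne', hy, neg_neg, Real.exp_log hApos]
    refine ⟨Z, hZD, ?_⟩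
    have e1 : PP τ (x • η + y • ξ) = 1 := by
      rw [PP_add_smul _ ξ 1 hξ, mul_one, hy, Real.exp_neg, Real.exp_log hApos]
      have : PP τ (x • η) = A := by
        refine Finset.sum_congr rfl fun k _ => ?_
        simp only [LinearMap.smul_apply, smul_eq_mul, hx]
        rw [show D * Real.log X * η (Real.log (τ k)) = (α k : ℝ) * Real.log X by rw [← hα]; ring,
          Real.exp_nat_mul, Real.exp_log hX]
      rw [this, inv_mul_cancel₀ hApos.ne']
    have e2 := heq2 _ e1
    rw [add_comm, PP_add_smul _ η 1 hη, mul_one] at e2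
    have e3 : PP ρ (y • ξ) = ∑ j, (Z ^ β j)⁻¹ := by
      refine Finset.sum_congr rfl fun k _ => ?_
      simp only [LinearMap.smul_apply, smul_eq_mul]
      rw [hZ, ← Real.exp_nat_mul, ← Real.exp_neg, ← hβ]
      congr 1
      field_simp
    have e4 : Real.exp x = X ^ D := by rw [hx, Real.exp_nat_mul, Real.exp_log hX]
    rw [e3, e4] at e2
    calc Z ^ β j0 = Z ^ β j0 * (X ^ D * ∑ j, (Z ^ β j)⁻¹) := by rw [e2, mul_one]
      _ = X ^ D * ∑ j, Z ^ (β j0 - β j) := by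
        rw [mul_left_comm, Finset.mul_sum]
        congr 1
        refine Finset.sum_congr rfl fun j _ => ?_
        rw [pow_sub₀ _ hZpos.ne' (hj0 j)])
  have hNpos : 0 < N := by
    obtain ⟨k⟩ := (inferInstance : Nonempty (Fin n))
    rw [← hN k]; exact hαpos k
  have hac : ∀ k, η (Real.log (τ k)) = (N : ℝ) / D := by
    intro k; rw [← hN k, ← hα k]; field_simp
  refine ⟨N, D, hNpos, hD, ms_eq _ _ fun r => ?_⟩
  rw [iterMS_sum, iterMS_sum]
  have hP : ∀ {l : ℕ} (σ : Fin l → ℝ), (∀ i, 0 < σ i) → PP σ ((r : ℝ) • LinearMap.id) = ∑ i, σ i ^ r := by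
    intro l σ hσ
    refine Finset.sum_congr rfl fun i _ => ?_
    simp only [LinearMap.smul_apply, LinearMap.id_apply, smul_eq_mul]
    rw [Real.exp_nat_mul, Real.exp_log (hσ i)]
  rw [← hP ρ hρ, ← hP τ hτ]
  set θ : ℝ →ₗ[ℚ] ℝ := (r : ℝ) • LinearMap.id
  have hpos : 0 < PP ρ θ := Finset.sum_pos (fun k _ => Real.exp_pos _) Finset.univ_nonempty
  set t := - Real.log (PP ρ θ) with ht
  have e1 : PP ρ (θ + t • η) = 1 := by
    rw [PP_add_smul _ η 1 hη, mul_one, ht, Real.exp_neg, Real.exp_log hpos, inv_mul_cancel₀ hpos.ne']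
  have e2 := heq1 _ e1
  rw [PP_add_smul _ η _ hac] at e2
  have e3 : PP τ θ = Real.exp (Real.log (PP ρ θ) * (N / D)) := by
    rw [ht, neg_mul, Real.exp_neg] at e2
    field_simp at e2
    rw [e2]
    congr 1
    ring
  rw [e3, ← Real.exp_nat_mul, show (D : ℝ) * (Real.log (PP ρ θ) * (N / D)) = N * Real.log (PP ρ θ) by field_simp,
    Real.exp_nat_mul, Real.exp_log hpos]

theorem coplanar_functional {m : ℕ} (ρ : Fin m → ℝ) (h : IsCoplanar ρ) :
    ∃ η : ℝ →ₗ[ℚ] ℝ, ∀ i, η (Real.log (ρ i)) = 1 := by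
  obtain ⟨s, lam, X, ⟨hpos, hli, hX, -⟩, e, he⟩ := h
  obtain ⟨η, hη⟩ := LinearMap.exists_extend ((Module.Basis.span hli).constr ℚ e)
  have hl : ∀ i, η (Real.log (lam i)) = e i := by
    intro i
    have h1 := LinearMap.congr_fun hη (Module.Basis.span hli i)
    rw [Module.Basis.constr_basis] at h1
    rw [← h1]
    simp [Module.Basis.span_apply]
  refine ⟨η, fun j => ?_⟩
  rw [hX, Real.log_prod (fun i _ => (zpow_pos (hpos i) _).ne'), map_sum, ← he j]
  refine Finset.sum_congr rfl fun i _ => ?_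
  rw [Real.log_zpow, ← zsmul_eq_mul, map_zsmul, hl, zsmul_eq_mul, mul_comm]


def pre {ι : Type} (x : ℕ → ι) (n : ℕ) : List ι := (List.range n).map x

theorem pre_length {ι : Type} (x : ℕ → ι) (n : ℕ) : (pre x n).length = n := by simp [pre]

theorem pre_succ {ι : Type} (x : ℕ → ι) (n : ℕ) : pre x (n + 1) = pre x n ++ [x n] := by
  simp [pre, List.range_succ]

theorem pre_eq_iff {ι : Type} {x y : ℕ → ι} {n : ℕ} : pre x n = pre y n ↔ ∀ t < n, x t = y t := by
  simp [pre, List.map_inj_left]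

theorem exists_first_diff {ι : Type} {x y : ℕ → ι} (h : x ≠ y) :
    ∃ n, pre x n = pre y n ∧ x n ≠ y n := by
  classical
  have h' : ∃ n, x n ≠ y n := by
    by_contra hcon; push Not at hcon; exact h (funext hcon)
  refine ⟨Nat.find h', pre_eq_iff.2 fun t ht => ?_, Nat.find_spec h'⟩
  have := Nat.find_min h' ht
  push Not at this
  exact this

theorem wt_pre_succ {ι : Type} (ρ : ι → ℝ) (x : ℕ → ι) (n : ℕ) :
    wt ρ (pre x (n + 1)) = wt ρ (pre x n) * ρ (x n) := by
  rw [pre_succ, wt_append]; simp [wt]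

theorem coding {d : ℕ} {ι : Type} [Fintype ι] (E : Set (EuclideanSpace ℝ (Fin d))) (ρ : ι → ℝ)
    (h : IsDustLike E ρ) : ∃ code : E → (ℕ → ι), Function.Bijective code ∧ ∃ c₁ c₂ : ℝ, 0 < c₁ ∧ 0 < c₂ ∧
      ∀ (x y : E) n, pre (code x) n = pre (code y) n → code x n ≠ code y n →
        c₁ * wt ρ (pre (code x) n) ≤ dist (x : EuclideanSpace ℝ (Fin d)) y ∧
        dist (x : EuclideanSpace ℝ (Fin d)) y ≤ c₂ * wt ρ (pre (code x) n) := by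
  classical
  obtain ⟨hcpt, hne, hρ, φ, hφ, hE, hdisj⟩ := h
  have hρ0 : ∀ i, 0 < ρ i := fun i => (hρ i).1
  have hex : ∀ x : E, ∃ (j : ι) (y : E), φ j y = x := by
    rintro ⟨x, hx⟩
    have hx' := hx
    rw [hE] at hx'
    obtain ⟨j, y, hy, hyx⟩ := Set.mem_iUnion.1 hx'
    exact ⟨j, ⟨y, hy⟩, hyx⟩
  choose J S hJS using hex
  have hφE : ∀ j (y : E), φ j y ∈ E := by
    intro j y; exact hE.ge (Set.mem_iUnion.2 ⟨j, y, y.2, rfl⟩)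
  have hJ : ∀ j (y x : E), φ j y = x → J x = j := by
    intro j y x hx
    by_contra hcon
    exact Set.disjoint_left.1 (hdisj hcon) ⟨_, (S x).2, hJS x⟩ ⟨y, y.2, hx⟩
  have hS : ∀ j (y x : E), φ j y = x → S x = y := by
    intro j y x hx
    have h1 := hJ j y x hx
    have h2 := hJS x
    rw [h1] at h2
    have h3 := hφ j (S x) y
    rw [h2, hx, dist_self] at h3
    apply Subtype.ext
    rw [← dist_eq_zero]
    exact (mul_eq_zero.1 h3.symm).resolve_left (hρ0 j).ne'
  let code : E → ℕ → ι := fun x t => J (S^[t] x)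
  have hA : ∀ n (x y : E), pre (code x) n = pre (code y) n →
      dist (x : EuclideanSpace ℝ (Fin d)) y = wt ρ (pre (code x) n) *
        dist ((S^[n] x : E) : EuclideanSpace ℝ (Fin d)) (S^[n] y : E) := by
    intro n
    induction n with
    | zero => intro x y _; simp [pre, wt]
    | succ n ih =>
      intro x y hxy
      have h1 : pre (code x) n = pre (code y) n := pre_eq_iff.2 fun t ht => pre_eq_iff.1 hxy t (by omega)
      have h2 : code x n = code y n := pre_eq_iff.1 hxy n (by omega)
      rw [ih x y h1, wt_pre_succ, mul_assoc]
      congr 1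
      rw [Function.iterate_succ_apply', Function.iterate_succ_apply', ← hφ]
      rw [show φ (code x n) (S (S^[n] x)) = (S^[n] x : E) from hJS _, h2,
        show φ (code y n) (S (S^[n] y)) = (S^[n] y : E) from hJS _]
  obtain ⟨e0, he0⟩ := hne
  have : Nonempty ι := ⟨J ⟨e0, he0⟩⟩
  have hcont : ∀ j, Continuous (φ j) := by
    intro j
    refine (LipschitzWith.of_dist_le_mul (K := (ρ j).toNNReal) fun x y => ?_).continuous
    rw [hφ, Real.coe_toNNReal _ (hρ0 j).le]
  have hgap : ∀ p : ι × ι, ∃ r : ℝ, 0 < r ∧ (p.1 ≠ p.2 → ∀ x ∈ φ p.1 '' E, ∀ y ∈ φ p.2 '' E, r ≤ dist x y) := by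
    rintro ⟨j, k⟩
    by_cases hjk : j = k
    · exact ⟨1, one_pos, fun h => absurd hjk h⟩
    · obtain ⟨r, hr, hrr⟩ := Metric.exists_pos_forall_lt_edist (hcpt.image (hcont j))
        (hcpt.image (hcont k)).isClosed (hdisj hjk)
      refine ⟨r, hr, fun _ x hx y hy => ?_⟩
      have := hrr x hx y hy
      rw [edist_nndist] at this
      have h2 : r < nndist x y := by exact_mod_cast this
      rw [← coe_nndist]
      exact_mod_cast h2.le
  choose r hr hrr using hgap
  obtain ⟨p0, hp0⟩ := Finite.exists_min r
  have hdiam : ∀ x y : E, dist (x : EuclideanSpace ℝ (Fin d)) y ≤ Metric.diam E := fun x y =>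
    Metric.dist_le_diam_of_mem hcpt.isBounded x.2 y.2
  have hcmp : ∀ (x y : E) n, pre (code x) n = pre (code y) n → code x n ≠ code y n →
        r p0 * wt ρ (pre (code x) n) ≤ dist (x : EuclideanSpace ℝ (Fin d)) y ∧
        dist (x : EuclideanSpace ℝ (Fin d)) y ≤ (Metric.diam E + 1) * wt ρ (pre (code x) n) := by
    intro x y n h1 h2
    rw [hA n x y h1]
    have hw := wt_pos hρ0 (pre (code x) n)
    constructor
    · rw [mul_comm]
      refine mul_le_mul_of_nonneg_left ?_ hw.le
      refine (hp0 (code x n, code y n)).trans (hrr (code x n, code y n) h2 _ ?_ _ ?_)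
      · exact ⟨_, (S (S^[n] x)).2, hJS _⟩
      · exact ⟨_, (S (S^[n] y)).2, hJS _⟩
    · rw [mul_comm]
      refine mul_le_mul_of_nonneg_right ?_ hw.le
      exact (hdiam _ _).trans (by linarith)
  refine ⟨code, ⟨?_, ?_⟩, r p0, Metric.diam E + 1, hr _, by have := Metric.diam_nonneg (s := E); linarith, hcmp⟩
  · intro x y hxy
    obtain ⟨j0, hj0⟩ := Finite.exists_max ρ
    apply Subtype.ext
    rw [← dist_le_zero]
    have hlim : Filter.Tendsto (fun n : ℕ => ρ j0 ^ n * Metric.diam E) Filter.atTop (nhds (0 * Metric.diam E)) :=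
      (tendsto_pow_atTop_nhds_zero_of_lt_one (hρ0 j0).le (hρ j0).2).mul_const _
    rw [zero_mul] at hlim
    refine ge_of_tendsto' hlim fun n => ?_
    rw [hA n x y (by rw [hxy])]
    refine mul_le_mul ?_ (hdiam _ _) dist_nonneg (pow_nonneg (hρ0 j0).le _)
    have := wt_le_pow hρ0 hj0 (pre (code x) n)
    rwa [pre_length] at this
  · intro s
    have hfin : ∀ n (s : ℕ → ι), ∃ y : E, ∀ t < n, code y t = s t := by
      intro n
      induction n with
      | zero => intro s; exact ⟨⟨e0, he0⟩, fun t ht => absurd ht (by omega)⟩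
      | succ n ih =>
        intro s
        obtain ⟨y, hy⟩ := ih (fun t => s (t + 1))
        refine ⟨⟨φ (s 0) y, hφE _ _⟩, fun t ht => ?_⟩
        rcases t with _ | t
        · exact hJ (s 0) y _ rfl
        · rw [← hy t (by omega)]
          simp only [code]
          rw [Function.iterate_succ_apply, hS (s 0) y ⟨φ (s 0) y, hφE _ _⟩ rfl]
    choose y hy using fun n => hfin n s
    obtain ⟨a, ha, ψ, hψ, hlim⟩ := hcpt.tendsto_subseq (x := fun n => (y n : EuclideanSpace ℝ (Fin d))) (fun n => (y n).2)
    refine ⟨⟨a, ha⟩, ?_⟩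
    by_contra hcon
    obtain ⟨n, hn1, hn2⟩ := exists_first_diff hcon
    have hpos : 0 < r p0 * wt ρ (pre s n) := mul_pos (hr _) (wt_pos hρ0 _)
    obtain ⟨N, hN⟩ := Metric.tendsto_atTop.1 hlim _ hpos
    have h1 := hN (max N (n + 1)) (le_max_left _ _)
    have h2 : n + 1 ≤ ψ (max N (n + 1)) := (le_max_right _ _).trans (hψ.id_le _)
    set q := ψ (max N (n + 1)) with hq
    have h3 : pre (code (y q)) n = pre s n := pre_eq_iff.2 fun t ht => hy q t (by omega)
    have h4 := (hcmp (y q) ⟨a, ha⟩ n (h3.trans hn1.symm) (by rw [hy q n (by omega)]; exact hn2.symm)).1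
    rw [h3] at h4
    simp only [Function.comp] at h1
    exact absurd h1 (not_lt.2 h4)

def Bil {ι κ : Type} (ρ : ι → ℝ) (τ : κ → ℝ) (h : (ℕ → ι) ≃ (ℕ → κ)) (C : ℝ) : Prop :=
  ∀ x y n l, pre x n = pre y n → x n ≠ y n → pre (h x) l = pre (h y) l → h x l ≠ h y l →
    wt τ (pre (h x) l) ≤ C * wt ρ (pre x n) ∧ wt ρ (pre x n) ≤ C * wt τ (pre (h x) l)

theorem Bil.symm {ι κ : Type} {ρ : ι → ℝ} {τ : κ → ℝ} {h : (ℕ → ι) ≃ (ℕ → κ)} {C : ℝ}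
    (hB : Bil ρ τ h C) : Bil τ ρ h.symm C := by
  intro x y n l h1 h2 h3 h4
  have := hB (h.symm x) (h.symm y) l n h3 h4 (by simpa using h1) (by simpa using h2)
  simp only [Equiv.apply_symm_apply] at this
  exact this.symm

theorem exists_bil {d d' : ℕ} {ι κ : Type} [Fintype ι] [Fintype κ]
    (E : Set (EuclideanSpace ℝ (Fin d))) (F : Set (EuclideanSpace ℝ (Fin d'))) (ρ : ι → ℝ) (τ : κ → ℝ)
    (hE : IsDustLike E ρ) (hF : IsDustLike F τ) (h : LipEquiv E F) :
    ∃ (h : (ℕ → ι) ≃ (ℕ → κ)) (C : ℝ), 0 < C ∧ Bil ρ τ h C := by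
  obtain ⟨cE, hcE, a₁, a₂, ha₁, ha₂, hEE⟩ := coding E ρ hE
  obtain ⟨cF, hcF, b₁, b₂, hb₁, hb₂, hFF⟩ := coding F τ hF
  obtain ⟨f, hf, C, hC, hCC⟩ := h
  have hC1 : 0 < C * a₂ / b₁ := by positivity
  have hC2 : 0 < C * b₂ / a₁ := by positivity
  refine ⟨((Equiv.ofBijective cE hcE).symm.trans (Equiv.ofBijective f hf)).trans (Equiv.ofBijective cF hcF),
    C * a₂ / b₁ + C * b₂ / a₁, by positivity, ?_⟩
  intro x y n l h1 h2 h3 h4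
  obtain ⟨x, rfl⟩ := hcE.2 x
  obtain ⟨y, rfl⟩ := hcE.2 y
  have hs : ∀ z, (Equiv.ofBijective cE hcE).symm (cE z) = z := fun z => (Equiv.ofBijective cE hcE).symm_apply_apply z
  simp only [Equiv.trans_apply, hs, Equiv.ofBijective_apply] at h3 h4 ⊢
  obtain ⟨e1, e2⟩ := hEE x y n h1 h2
  obtain ⟨e3, e4⟩ := hFF (f x) (f y) l h3 h4
  obtain ⟨e5, e6⟩ := hCC x y
  have w1 := wt_pos (fun i => (hE.2.2.1 i).1) (pre (cE x) n)
  have w2 := wt_pos (fun i => (hF.2.2.1 i).1) (pre (cF (f x)) l)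
  have e7 : dist (x : EuclideanSpace ℝ (Fin d)) y ≤ C * dist (f x : EuclideanSpace ℝ (Fin d')) (f y) := by
    rwa [inv_mul_le_iff₀ hC] at e5
  constructor
  · have : wt τ (pre (cF (f x)) l) ≤ C * a₂ / b₁ * wt ρ (pre (cE x) n) := by
      rw [div_mul_eq_mul_div, le_div_iff₀ hb₁, mul_comm, mul_assoc]
      exact e3.trans (e6.trans (mul_le_mul_of_nonneg_left e2 hC.le))
    nlinarith
  · have : wt ρ (pre (cE x) n) ≤ C * b₂ / a₁ * wt τ (pre (cF (f x)) l) := by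
      rw [div_mul_eq_mul_div, le_div_iff₀ ha₁, mul_comm, mul_assoc]
      exact e1.trans (e7.trans (mul_le_mul_of_nonneg_left e4 hC.le))
    nlinarith

theorem lipEquiv_of_same {d d' : ℕ} {ι : Type} [Fintype ι]
    (E : Set (EuclideanSpace ℝ (Fin d))) (F : Set (EuclideanSpace ℝ (Fin d'))) (ρ : ι → ℝ)
    (hE : IsDustLike E ρ) (hF : IsDustLike F ρ) : LipEquiv E F := by
  obtain ⟨cE, hcE, a₁, a₂, ha₁, ha₂, hEE⟩ := coding E ρ hE
  obtain ⟨cF, hcF, b₁, b₂, hb₁, hb₂, hFF⟩ := coding F ρ hF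
  have hC1 : 0 < a₂ / b₁ := by positivity
  have hC2 : 0 < b₂ / a₁ := by positivity
  refine ⟨(Equiv.ofBijective cE hcE).trans (Equiv.ofBijective cF hcF).symm, Equiv.bijective _,
    a₂ / b₁ + b₂ / a₁, by positivity, ?_⟩
  intro x y
  obtain ⟨u, hu⟩ := hcF.2 (cE x)
  obtain ⟨v, hv⟩ := hcF.2 (cE y)
  have hs : ∀ z, (Equiv.ofBijective cF hcF).symm (cF z) = z := fun z => (Equiv.ofBijective cF hcF).symm_apply_apply z
  simp only [Equiv.trans_apply, Equiv.ofBijective_apply, ← hu, ← hv, hs]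
  by_cases hxy : x = y
  · subst hxy
    have : u = v := hcF.1 (hu.trans hv.symm)
    subst this
    simp
  obtain ⟨n, h1, h2⟩ := exists_first_diff (fun h => hxy (hcE.1 h))
  obtain ⟨e1, e2⟩ := hEE x y n h1 h2
  obtain ⟨e3, e4⟩ := hFF u v n (by rw [hu, hv, h1]) (by rw [hu, hv]; exact h2)
  rw [hu] at e3 e4
  have w1 := wt_pos (fun i => (hE.2.2.1 i).1) (pre (cE x) n)
  set w := wt ρ (pre (cE x) n)
  have d1 := dist_nonneg (x := (x : EuclideanSpace ℝ (Fin d))) (y := y)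
  have d2 := dist_nonneg (x := (u : EuclideanSpace ℝ (Fin d'))) (y := v)
  constructor
  · rw [inv_mul_le_iff₀ (by positivity)]
    have : dist (x : EuclideanSpace ℝ (Fin d)) y ≤ a₂ / b₁ * dist (u : EuclideanSpace ℝ (Fin d')) v := by
      rw [div_mul_eq_mul_div, le_div_iff₀ hb₁]
      nlinarith
    nlinarith
  · have : dist (u : EuclideanSpace ℝ (Fin d')) v ≤ b₂ / a₁ * dist (x : EuclideanSpace ℝ (Fin d)) y := by
      rw [div_mul_eq_mul_div, le_div_iff₀ ha₁]
      nlinarith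
    nlinarith


def cyl {ι : Type} (k : List ι) : Set (ℕ → ι) := {x | pre x k.length = k}

theorem mem_cyl {ι : Type} {k : List ι} {x : ℕ → ι} : x ∈ cyl k ↔ pre x k.length = k := Iff.rfl

theorem mem_cyl_iff {ι : Type} {k : List ι} {x : ℕ → ι} :
    x ∈ cyl k ↔ ∀ t (h : t < k.length), x t = k[t] := by
  rw [mem_cyl]
  constructor
  · intro h t ht
    have h2 : (pre x k.length)[t]'(by rw [pre_length]; exact ht) = k[t] := by simp only [h]
    rw [← h2]; simp [pre]
  · intro h
    apply List.ext_getElem (by simp [pre])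
    intro t h1 h2
    rw [← h t h2]; simp [pre]

theorem cyl_nonempty {ι : Type} [Nonempty ι] (k : List ι) : (cyl k).Nonempty := by
  obtain ⟨a⟩ := (inferInstance : Nonempty ι)
  refine ⟨fun t => k.getD t a, mem_cyl_iff.2 fun t ht => ?_⟩
  simp [List.getD_eq_getElem?_getD, ht]

theorem cyl_inj_aux {ι : Type} [Nontrivial ι] {k l : List ι} (h : cyl k = cyl l) : l.length ≤ k.length := by
  classical
  by_contra hlt
  push Not at hlt
  obtain ⟨x, hx⟩ := cyl_nonempty k
  obtain ⟨b, hb⟩ := exists_ne (x k.length)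
  have h2 : Function.update x k.length b ∈ cyl k := by
    rw [mem_cyl_iff] at hx ⊢
    intro t ht
    rw [Function.update_of_ne (by omega), hx t ht]
  rw [h] at hx h2
  rw [mem_cyl_iff] at hx h2
  have e1 := hx _ hlt
  have e2 := h2 _ hlt
  rw [Function.update_self] at e2
  exact hb (e2.trans e1.symm)

theorem cyl_inj {ι : Type} [Nontrivial ι] {k l : List ι} (h : cyl k = cyl l) : k = l := by
  have hl : k.length = l.length := le_antisymm (cyl_inj_aux h.symm) (cyl_inj_aux h)
  obtain ⟨x, hx⟩ := cyl_nonempty k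
  have hx2 : x ∈ cyl l := h ▸ hx
  rw [mem_cyl] at hx hx2
  rw [← hx, ← hx2, hl]

theorem cyl_disj {ι : Type} {k l : List ι} (hl : k.length = l.length) (h : k ≠ l) : Disjoint (cyl k) (cyl l) := by
  rw [Set.disjoint_left]
  intro x hx hx2
  rw [mem_cyl] at hx hx2
  rw [hl] at hx
  exact h (hx.symm.trans hx2)

theorem cyl_split {ι : Type} [Fintype ι] (k : List ι) :
    cyl k = ⋃ j ∈ (Finset.univ : Finset ι), cyl (k ++ [j]) := by
  ext x
  simp only [Finset.mem_univ, Set.iUnion_true, Set.mem_iUnion, mem_cyl, List.length_append, List.length_singleton,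
    pre_succ]
  constructor
  · intro h; exact ⟨x k.length, by rw [h]⟩
  · rintro ⟨j, hj⟩
    exact (List.append_inj' hj rfl).1

theorem pre_add {ι : Type} (x : ℕ → ι) (l M : ℕ) :
    pre x (l + M) = pre x l ++ List.ofFn (fun t : Fin M => x (l + t)) := by
  induction M with
  | zero => simp
  | succ M ih =>
    rw [← add_assoc, pre_succ, ih, List.ofFn_succ', List.append_assoc]
    simp

theorem wt_pre_anti {ι : Type} {ρ : ι → ℝ} (h : ∀ i, 0 < ρ i) (hc : ∀ i, ρ i < 1) (x : ℕ → ι) :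
    Antitone (fun n => wt ρ (pre x n)) := by
  refine antitone_nat_of_succ_le fun n => ?_
  rw [wt_pre_succ]
  have := wt_pos h (pre x n)
  have := hc (x n)
  nlinarith

theorem sat {ι κ : Type} {ρ : ι → ℝ} {τ : κ → ℝ}
    (hρ : ∀ i, 0 < ρ i) (hρ1 : ∀ i, ρ i < 1) (hτ : ∀ i, 0 < τ i) (hτ1 : ∀ i, τ i < 1)
    {h : (ℕ → ι) ≃ (ℕ → κ)} {C : ℝ} (hC : 0 < C) (hB : Bil ρ τ h C) (k : List ι) (x : ℕ → ι) (hx : x ∈ cyl k)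
    (z : ℕ → κ) (L : ℕ) (hz : pre z L = pre (h x) L) (hw : C * wt τ (pre (h x) L) < wt ρ k) :
    h.symm z ∈ cyl k := by
  by_contra hcon
  have hne : x ≠ h.symm z := by rintro rfl; exact hcon hx
  obtain ⟨t, ht1, ht2⟩ := exists_first_diff hne
  have hne' : h x ≠ h (h.symm z) := fun e => hne (h.injective e)
  obtain ⟨s, hs1, hs2⟩ := exists_first_diff hne'
  have h1 := (hB x (h.symm z) t s ht1 ht2 hs1 hs2).2
  have htk : t < k.length := by
    by_contra hle
    push Not at hle
    apply hcon
    rw [mem_cyl] at hx ⊢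
    rw [← hx, pre_length]
    exact pre_eq_iff.2 fun r hr => (pre_eq_iff.1 ht1 r (by omega)).symm
  have hsL : L ≤ s := by
    by_contra hlt
    push Not at hlt
    apply hs2
    rw [h.apply_symm_apply]
    exact (pre_eq_iff.1 hz s hlt).symm
  have h2 := wt_pre_anti hρ hρ1 x htk.le
  have h3 := wt_pre_anti hτ hτ1 (h x) hsL
  simp only at h2 h3
  rw [mem_cyl.1 hx] at h2
  nlinarith

theorem union_form {ι κ : Type} [Fintype κ] [Nonempty ι] {ρ : ι → ℝ} {τ : κ → ℝ}
    (hρ : ∀ i, 0 < ρ i) (hρ1 : ∀ i, ρ i < 1) (hτ : ∀ i, 0 < τ i) (hτ1 : ∀ i, τ i < 1)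
    {h : (ℕ → ι) ≃ (ℕ → κ)} {C : ℝ} (hC : 0 < C) (hB : Bil ρ τ h C) (k : List ι) (w : List κ)
    (M : ℕ) (c : ℝ) (hc : ∀ i, τ i ≤ c) (hkw : ∀ x ∈ cyl k, h x ∈ cyl w)
    (hw : C * (wt τ w * c ^ M) < wt ρ k) :
    ∃ A : Finset (Fin M → κ), A.Nonempty ∧ h '' cyl k = ⋃ u ∈ A, cyl (w ++ List.ofFn u) := by
  classical
  let A : Finset (Fin M → κ) := Finset.univ.filter fun u => ∃ x ∈ cyl k, h x ∈ cyl (w ++ List.ofFn u)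
  have hin : ∀ x ∈ cyl k, ∃ u ∈ A, h x ∈ cyl (w ++ List.ofFn u) := by
    intro x hx
    have h1 : h x ∈ cyl (w ++ List.ofFn (fun t : Fin M => h x (w.length + t))) := by
      rw [mem_cyl, List.length_append, List.length_ofFn, pre_add, mem_cyl.1 (hkw x hx)]
    exact ⟨_, Finset.mem_filter.2 ⟨Finset.mem_univ _, x, hx, h1⟩, h1⟩
  refine ⟨A, ?_, ?_⟩
  · obtain ⟨x, hx⟩ := cyl_nonempty k
    obtain ⟨u, hu, -⟩ := hin x hx
    exact ⟨u, hu⟩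
  · ext z
    simp only [Set.mem_iUnion, Set.mem_image, exists_prop]
    constructor
    · rintro ⟨x, hx, rfl⟩
      exact hin x hx
    · rintro ⟨u, hu, hz⟩
      obtain ⟨x, hx, hxu⟩ := (Finset.mem_filter.1 hu).2
      refine ⟨h.symm z, ?_, h.apply_symm_apply z⟩
      refine sat hρ hρ1 hτ hτ1 hC hB k x hx z _ ((mem_cyl.1 hz).trans (mem_cyl.1 hxu).symm) (lt_of_le_of_lt ?_ hw)
      rw [mem_cyl.1 hxu, wt_append]
      have h1 := wt_le_pow hτ hc (List.ofFn u)
      rw [List.length_ofFn] at h1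
      have h2 := wt_pos hτ w
      gcongr

theorem exists_word {ι κ : Type} [Fintype κ] [Nonempty ι] [Nonempty κ] {ρ : ι → ℝ} {τ : κ → ℝ}
    (hρ : ∀ i, 0 < ρ i) (hρ1 : ∀ i, ρ i < 1) (hτ : ∀ i, 0 < τ i) (hτ1 : ∀ i, τ i < 1)
    {h : (ℕ → ι) ≃ (ℕ → κ)} {C : ℝ} (hC : 0 < C) (hB : Bil ρ τ h C) :
    ∃ K : ℝ, 0 < K ∧ ∀ i : List ι, ∃ w : List κ, wt ρ i ≤ wt τ w ∧ wt τ w ≤ K * wt ρ i ∧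
      ∀ x ∈ cyl i, h x ∈ cyl w := by
  classical
  obtain ⟨jm, hjm⟩ := Finite.exists_min τ
  obtain ⟨jM, hjM⟩ := Finite.exists_max τ
  refine ⟨(C + 1) / τ jm, div_pos (by linarith) (hτ _), fun i => ?_⟩
  obtain ⟨x, hx⟩ := cyl_nonempty i
  have hi := wt_pos hρ i
  have hex : ∃ l, wt τ (pre (h x) (l + 1)) < (C + 1) * wt ρ i := by
    obtain ⟨l, hl⟩ := exists_pow_lt_of_lt_one (show 0 < (C + 1) * wt ρ i by positivity) (hτ1 jM)
    refine ⟨l, lt_of_le_of_lt ?_ hl⟩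
    refine le_trans ?_ ((wt_le_pow hτ hjM (pre (h x) l)).trans_eq (by rw [pre_length]))
    exact wt_pre_anti hτ hτ1 (h x) (Nat.le_succ l)
  set l := Nat.find hex with hl
  have hl1 : wt τ (pre (h x) (l + 1)) < (C + 1) * wt ρ i := Nat.find_spec hex
  have hl2 : ∀ t < l, (C + 1) * wt ρ i ≤ wt τ (pre (h x) (t + 1)) := fun t ht => not_lt.1 (Nat.find_min hex ht)
  refine ⟨pre (h x) l, ?_, ?_, ?_⟩
  · rcases Nat.eq_zero_or_pos l with h0 | h0
    · rw [h0]; simpa [pre, wt] using wt_le_one hρ hρ1 i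
    · have := hl2 (l - 1) (by omega)
      rw [Nat.sub_add_cancel h0] at this
      nlinarith
  · rw [div_mul_eq_mul_div, le_div_iff₀ (hτ _)]
    rw [wt_pre_succ] at hl1
    have := mul_le_mul_of_nonneg_left (hjm (h x l)) (wt_pos hτ (pre (h x) l)).le
    linarith
  · intro z hz
    rw [mem_cyl, pre_length]
    by_contra hcon
    have hne : h x ≠ h z := by intro e; rw [e] at hcon; exact hcon rfl
    obtain ⟨t, ht1, ht2⟩ := exists_first_diff hne
    obtain ⟨s, hs1, hs2⟩ := exists_first_diff (fun e : x = z => hne (by rw [e]))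
    have htl : t < l := by
      by_contra hle
      push Not at hle
      exact hcon (pre_eq_iff.2 fun r hr => (pre_eq_iff.1 ht1 r (by omega)).symm)
    have hsi : i.length ≤ s := by
      by_contra hlt
      push Not at hlt
      apply hs2
      rw [mem_cyl_iff.1 hx s hlt, mem_cyl_iff.1 hz s hlt]
    have e1 := (hB x z s t hs1 hs2 ht1 ht2).1
    have e2 := wt_pre_anti hρ hρ1 x hsi
    have e3 := wt_pre_anti hτ hτ1 (h x) (Nat.le_succ t)
    have e4 := hl2 t htl
    simp only at e2 e3
    rw [mem_cyl.1 hx] at e2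
    have e5 : C * wt ρ (pre x s) ≤ C * wt ρ i := mul_le_mul_of_nonneg_left e2 hC.le
    simp only [Nat.succ_eq_add_one] at e3
    linarith

theorem structure_lemma {ι κ : Type} [Fintype ι] [Fintype κ] [Nonempty ι] [Nonempty κ] {ρ : ι → ℝ} {τ : κ → ℝ}
    (hρ : ∀ i, 0 < ρ i) (hρ1 : ∀ i, ρ i < 1) (hτ : ∀ i, 0 < τ i) (hτ1 : ∀ i, τ i < 1)
    {h : (ℕ → ι) ≃ (ℕ → κ)} {C : ℝ} (hC : 0 < C) (hB : Bil ρ τ h C) :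
    ∃ (K : ℝ) (M : ℕ), 0 < K ∧ ∀ i : List ι, ∃ w : List κ, wt ρ i ≤ wt τ w ∧ wt τ w ≤ K * wt ρ i ∧
      (∃ A : Finset (Fin M → κ), A.Nonempty ∧ h '' cyl i = ⋃ u ∈ A, cyl (w ++ List.ofFn u)) ∧
      ∀ j, ∃ A : Finset (Fin M → κ), A.Nonempty ∧ h '' cyl (i ++ [j]) = ⋃ u ∈ A, cyl (w ++ List.ofFn u) := by
  obtain ⟨K, hK, hw⟩ := exists_word hρ hρ1 hτ hτ1 hC hB
  obtain ⟨jm, hjm⟩ := Finite.exists_min ρ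
  obtain ⟨jM, hjM⟩ := Finite.exists_max τ
  obtain ⟨M, hM⟩ := exists_pow_lt_of_lt_one (show 0 < ρ jm / (C * K) from div_pos (hρ _) (by positivity)) (hτ1 jM)
  rw [lt_div_iff₀ (by positivity)] at hM
  refine ⟨K, M, hK, fun i => ?_⟩
  obtain ⟨w, h1, h2, h3⟩ := hw i
  have hi := wt_pos hρ i
  have hp : 0 < τ jM ^ M := pow_pos (hτ _) _
  have key : C * (wt τ w * τ jM ^ M) < ρ jm * wt ρ i := by
    calc C * (wt τ w * τ jM ^ M) ≤ C * ((K * wt ρ i) * τ jM ^ M) := by gcongr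
      _ = (τ jM ^ M * (C * K)) * wt ρ i := by ring
      _ < _ := by gcongr
  refine ⟨w, h1, h2, ?_, fun j => ?_⟩
  · refine union_form hρ hρ1 hτ hτ1 hC hB i w M (τ jM) hjM h3 (key.trans_le ?_)
    have := hρ1 jm
    nlinarith
  · refine union_form hρ hρ1 hτ hτ1 hC hB (i ++ [j]) w M (τ jM) hjM (fun x hx => h3 x ?_) (key.trans_le ?_)
    · rw [cyl_split i]
      exact Set.mem_biUnion (Finset.mem_univ j) hx
    · rw [wt_append, mul_comm]
      have := hjm j
      simp only [wt, List.map_cons, List.map_nil, List.prod_singleton]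
      exact mul_le_mul_of_nonneg_left this hi.le

theorem exists_nu {κ : Type} [Fintype κ] (q : κ → ℝ) (hq : ∀ k, 0 < q k) (hq1 : ∑ k, q k = 1) :
    ∃ (G : Set (Set (ℕ → κ))) (ν : Set (ℕ → κ) → ℝ), (∀ w, cyl w ∈ G) ∧
      (∀ (α : Type) (A : Finset α) (f : α → Set (ℕ → κ)), (∀ a ∈ A, f a ∈ G) → (⋃ a ∈ A, f a) ∈ G) ∧
      (∀ (α : Type) (A : Finset α) (f : α → Set (ℕ → κ)), (∀ a ∈ A, f a ∈ G) →
        (A : Set α).PairwiseDisjoint f → ν (⋃ a ∈ A, f a) = ∑ a ∈ A, ν (f a)) ∧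
      ∀ w, ν (cyl w) = wt q w := by
  classical
  letI : MeasurableSpace κ := ⊤
  let P : PMF κ := PMF.ofFintype (fun k => ENNReal.ofReal (q k)) (by
    rw [← ENNReal.ofReal_sum_of_nonneg (fun k _ => (hq k).le), hq1, ENNReal.ofReal_one])
  let μ := MeasureTheory.Measure.infinitePi (fun _ : ℕ => P.toMeasure)
  have hcyl : ∀ w : List κ, cyl w = (↑(Finset.range w.length) : Set ℕ).pi
      (fun t => {k | ∀ h : t < w.length, k = w[t]}) := by
    intro w
    ext x
    simp only [mem_cyl_iff, Set.mem_pi, Finset.coe_range, Set.mem_Iio, Set.mem_ofPred_eq]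
    exact ⟨fun h t ht _ => h t ht, fun h t ht => h t ht ht⟩
  refine ⟨{S | MeasurableSet S}, fun S => μ.real S, ?_, ?_, ?_, ?_⟩
  · intro w
    rw [Set.mem_ofPred_eq, hcyl]
    exact MeasurableSet.pi (Finset.countable_toSet _) (fun t _ => MeasurableSpace.measurableSet_top)
  · intro α A f hf
    simp only [Set.mem_ofPred_eq] at hf ⊢
    exact Finset.measurableSet_biUnion A hf
  · intro α A f hf hd
    exact MeasureTheory.measureReal_biUnion_finset hd hf
  · intro w
    show (μ (cyl w)).toReal = _
    rw [hcyl, MeasureTheory.Measure.infinitePi_pi _ (fun t _ => MeasurableSpace.measurableSet_top), ENNReal.toReal_prod]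
    rw [wt, ← Fin.prod_univ_fun_getElem w q, Finset.prod_range]
    refine Finset.prod_congr rfl fun t _ => ?_
    have : {k | ∀ h : (t : ℕ) < w.length, k = w[(t : ℕ)]} = {w[(t : ℕ)]} := by
      ext k; simp
    rw [this, PMF.toMeasure_apply_singleton _ _ (MeasurableSpace.measurableSet_top)]
    simp [P, (hq _).le]


theorem const_of_finite_ratio {ι : Type} [Fintype ι] [Nonempty ι] (p : ι → ℝ) (hp : ∀ j, 0 < p j)
    (T : List ι → ℝ) (c0 c1 : ℝ) (hc0 : 0 < c0) (h0 : ∀ i, c0 ≤ T i) (h1 : ∀ i, T i ≤ c1)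
    (hT : ∀ i, T i = ∑ j, p j * T (i ++ [j])) (R : Set ℝ) (hR : R.Finite)
    (hrat : ∀ i j, T (i ++ [j]) / T i ∈ R) : ∃ i0, ∀ k, T (i0 ++ k) = T i0 := by
  classical
  have hpos : ∀ i, 0 < T i := fun i => hc0.trans_le (h0 i)
  have hbb : BddBelow (Set.range T) := ⟨c0, by rintro _ ⟨i, rfl⟩; exact h0 i⟩
  have hba : BddAbove (Set.range T) := ⟨c1, by rintro _ ⟨i, rfl⟩; exact h1 i⟩
  set S := ⨆ i, T i with hS
  set I := ⨅ i, T i with hI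
  have hTS : ∀ i, T i ≤ S := fun i => le_ciSup hba i
  have hIT : ∀ i, I ≤ T i := fun i => ciInf_le hbb i
  have hI0 : 0 < I := hc0.trans_le (le_ciInf h0)
  have hS0 : 0 < S := (hpos []).trans_le (hTS [])
  set σ := ∑ j, p j with hσ
  have hσ1 : σ = 1 := by
    apply le_antisymm
    · have : σ * I ≤ I := by
        refine le_ciInf fun i => ?_
        rw [hT i, hσ, Finset.sum_mul]
        exact Finset.sum_le_sum fun j _ => mul_le_mul_of_nonneg_left (hIT _) (hp j).le
      nlinarith
    · have : S ≤ σ * S := by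
        refine ciSup_le fun i => ?_
        rw [hT i, hσ, Finset.sum_mul]
        exact Finset.sum_le_sum fun j _ => mul_le_mul_of_nonneg_left (hTS _) (hp j).le
      nlinarith
  obtain ⟨δ, hδ0, hδ1, hδ⟩ : ∃ δ : ℝ, 0 < δ ∧ δ ≤ 1 ∧ ∀ r ∈ R, r < 1 → r ≤ 1 - δ := by
    have hf : (R ∩ Set.Iio 1).Finite := hR.inter_of_left _
    rcases (R ∩ Set.Iio 1).eq_empty_or_nonempty with he | hne
    · refine ⟨1, one_pos, le_rfl, fun r hr h => ?_⟩
      have : r ∈ R ∩ Set.Iio 1 := ⟨hr, h⟩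
      rw [he] at this; exact this.elim
    · obtain ⟨M, hM, hMM⟩ := Set.exists_max_image (R ∩ Set.Iio 1) id hf hne
      have hM1 : M < 1 := hM.2
      refine ⟨min 1 (1 - M), lt_min one_pos (by linarith), min_le_left _ _, fun r hr h => ?_⟩
      have := hMM r ⟨hr, h⟩
      have h2 := min_le_right 1 (1 - M)
      simp only [id] at this
      linarith
  obtain ⟨jm, hjm⟩ := Finite.exists_min p
  have hε : 0 < δ * p jm := mul_pos hδ0 (hp _)
  obtain ⟨i0, hi0⟩ : ∃ i0, S * (1 - δ * p jm) < T i0 := exists_lt_of_lt_ciSup (by rw [← hS]; nlinarith)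
  refine ⟨i0, fun k => ?_⟩
  induction k using List.reverseRecOn with
  | nil => simp
  | append_singleton k j ih =>
    rw [← ih, ← List.append_assoc]
    have hi : S * (1 - δ * p jm) < T (i0 ++ k) := by rw [ih]; exact hi0
    generalize i0 ++ k = i at hi
    have hsum : ∑ j, p j * (S - T (i ++ [j])) = S - T i := by
      simp only [mul_sub, Finset.sum_sub_distrib]
      rw [← hT i, ← Finset.sum_mul, ← hσ, hσ1, one_mul]
    have hge : ∀ j, T i ≤ T (i ++ [j]) := by
      intro j
      by_contra hlt
      push Not at hlt
      have hr : T (i ++ [j]) / T i < 1 := (div_lt_one (hpos i)).2 hlt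
      have h2 := hδ _ (hrat i j) hr
      rw [div_le_iff₀ (hpos i)] at h2
      have h3 : p j * (S - T (i ++ [j])) ≤ S - T i := by
        rw [← hsum]
        exact Finset.single_le_sum (f := fun j => p j * (S - T (i ++ [j])))
          (fun j _ => mul_nonneg (hp j).le (sub_nonneg.2 (hTS _))) (Finset.mem_univ j)
      have h4 : δ * S ≤ S - T (i ++ [j]) := by
        have := mul_le_mul_of_nonneg_left (hTS i) (sub_nonneg.2 hδ1)
        linarith
      have h5 : p jm * (δ * S) ≤ p j * (S - T (i ++ [j])) :=
        mul_le_mul (hjm j) h4 (by positivity) (hp j).le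
      linarith
    have hz : ∑ j, p j * (T (i ++ [j]) - T i) = 0 := by
      simp only [mul_sub, Finset.sum_sub_distrib]
      rw [← hT i, ← Finset.sum_mul, ← hσ, hσ1, one_mul, sub_self]
    rw [Finset.sum_eq_zero_iff_of_nonneg (fun j _ => mul_nonneg (hp j).le (sub_nonneg.2 (hge j)))] at hz
    have := (mul_eq_zero.1 (hz j (Finset.mem_univ j))).resolve_left (hp j).ne'
    linarith


theorem dust_prod {d : ℕ} {ι κ : Type} [Fintype ι] [Fintype κ] {E : Set (EuclideanSpace ℝ (Fin d))}
    {ρ : ι → ℝ} {τ : κ → ℝ} (h1 : IsDustLike E ρ) (h2 : IsDustLike E τ) :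
    IsDustLike E (fun p : ι × κ => ρ p.1 * τ p.2) := by
  obtain ⟨hc, hne, hρ, φ, hφ, hφE, hφd⟩ := h1
  obtain ⟨-, -, hτ, ψ, hψ, hψE, hψd⟩ := h2
  have hinj : ∀ i, Function.Injective (φ i) := by
    intro i x y hxy
    have := hφ i x y
    rw [hxy, dist_self] at this
    exact dist_eq_zero.1 ((mul_eq_zero.1 this.symm).resolve_left (hρ i).1.ne')
  have hsub : ∀ k, ψ k '' E ⊆ E := fun k => by
    conv_rhs => rw [hψE]
    exact Set.subset_iUnion (fun k => ψ k '' E) k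
  refine ⟨hc, hne, fun p => ⟨mul_pos (hρ _).1 (hτ _).1, ?_⟩, fun p => φ p.1 ∘ ψ p.2, ?_, ?_, ?_⟩
  · exact mul_lt_one_of_nonneg_of_lt_one_left (hρ _).1.le (hρ _).2 (hτ _).2.le
  · intro p x y
    simp only [Function.comp, hφ, hψ, mul_assoc]
  · rw [Set.iUnion_prod']
    conv_lhs => rw [hφE]
    refine Set.iUnion_congr fun i => ?_
    simp only [Set.image_comp]
    rw [← Set.image_iUnion, ← hψE]
  · rintro ⟨i, k⟩ ⟨i', k'⟩ hne
    simp only [Set.image_comp]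
    by_cases hi : i = i'
    · subst hi
      have hk : k ≠ k' := by rintro rfl; exact hne rfl
      exact (Set.disjoint_image_iff (hinj i)).2 (hψd hk)
    · exact (hφd hi).mono (Set.image_mono (hsub k)) (Set.image_mono (hsub k'))

theorem dust_reindex {d : ℕ} {ι κ : Type} [Fintype ι] [Fintype κ] {E : Set (EuclideanSpace ℝ (Fin d))}
    {ρ : ι → ℝ} {τ : κ → ℝ} (h1 : IsDustLike E ρ) (e : κ ≃ ι) (he : ∀ k, τ k = ρ (e k)) :
    IsDustLike E τ := by
  obtain ⟨hc, hne, hρ, φ, hφ, hφE, hφd⟩ := h1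
  refine ⟨hc, hne, fun k => he k ▸ hρ _, fun k => φ (e k), fun k x y => ?_, ?_, ?_⟩
  · rw [hφ, he]
  · rw [e.surjective.iUnion_comp (fun i => φ i '' E)]; exact hφE
  · intro j k hjk
    exact hφd (fun h => hjk (e.injective h))

theorem dust_iter {d m : ℕ} {E : Set (EuclideanSpace ℝ (Fin d))} {ρ : Fin m → ℝ} (h : IsDustLike E ρ) (p : ℕ) :
    IsDustLike E (fun f : Fin (p + 1) → Fin m => ∏ t, ρ (f t)) := by
  induction p with
  | zero => exact dust_reindex h (Equiv.funUnique (Fin 1) (Fin m)) (fun f => by simp)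
  | succ p ih =>
    refine dust_reindex (dust_prod h ih) (Fin.consEquiv (fun _ => Fin m)).symm (fun f => ?_)
    rw [Fin.prod_univ_succ]
    rfl

theorem equiv_of_map_eq {α β : Type} [Fintype α] [Fintype β] (f : α → ℝ) (g : β → ℝ)
    (h : (Finset.univ : Finset α).val.map f = (Finset.univ : Finset β).val.map g) :
    ∃ e : α ≃ β, ∀ a, f a = g (e a) := by
  classical
  have hcard : ∀ c : ℝ, Nonempty ({a // f a = c} ≃ {b // g b = c}) := by
    intro c
    have h2 := congrArg (Multiset.count c) h
    rw [Multiset.count_map, Multiset.count_map] at h2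
    rw [← Fintype.card_eq, Fintype.card_subtype, Fintype.card_subtype]
    simp only [Finset.card, Finset.filter_val, eq_comm (a := c)] at h2 ⊢
    exact h2
  have F := fun c => (hcard c).some
  refine ⟨(Equiv.sigmaFiberEquiv f).symm.trans ((Equiv.sigmaCongrRight F).trans (Equiv.sigmaFiberEquiv g)), fun a => ?_⟩
  exact ((F (f a)) ⟨a, rfl⟩).2.symm

theorem conv_dir {d d' m n : ℕ} (ρ : Fin m → ℝ) (τ : Fin n → ℝ)
    (E : Set (EuclideanSpace ℝ (Fin d))) (F : Set (EuclideanSpace ℝ (Fin d')))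
    (hE : IsDustLike E ρ) (hF : IsDustLike F τ) (p q : ℕ) (hp : 0 < p) (hq : 0 < q)
    (h : iterMS ρ p = iterMS τ q) : LipEquiv E F := by
  obtain ⟨p, rfl⟩ := Nat.exists_eq_succ_of_ne_zero hp.ne'
  obtain ⟨q, rfl⟩ := Nat.exists_eq_succ_of_ne_zero hq.ne'
  obtain ⟨e, he⟩ := equiv_of_map_eq _ _ h
  exact lipEquiv_of_same E F _ (dust_iter hE p) (dust_reindex (dust_iter hF q) e he)


theorem exists_dim {κ : Type} [Fintype κ] [Nontrivial κ] {τ : κ → ℝ} (hτ : ∀ i, 0 < τ i) (hτ1 : ∀ i, τ i < 1) :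
    ∃ s : ℝ, 0 < s ∧ ∑ k, τ k ^ s = 1 := by
  obtain ⟨jM, hjM⟩ := Finite.exists_max τ
  have hcard : (2 : ℝ) ≤ Fintype.card κ := by exact_mod_cast Fintype.one_lt_card (α := κ)
  obtain ⟨N, hN⟩ := exists_pow_lt_of_lt_one (show (0 : ℝ) < 1 / Fintype.card κ by positivity) (hτ1 jM)
  have hcont : Continuous (fun s : ℝ => ∑ k, τ k ^ s) :=
    continuous_finsetSum _ fun k _ => Real.continuous_const_rpow (hτ k).ne'
  have hmem : (1 : ℝ) ∈ Set.Icc (∑ k, τ k ^ (N : ℝ)) (∑ k, τ k ^ (0 : ℝ)) := by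
    constructor
    · calc ∑ k, τ k ^ (N : ℝ) ≤ ∑ k : κ, τ jM ^ N := by
            refine Finset.sum_le_sum fun k _ => ?_
            rw [Real.rpow_natCast]
            exact pow_le_pow_left₀ (hτ k).le (hjM k) N
        _ = Fintype.card κ * τ jM ^ N := by simp
        _ ≤ 1 := by
            rw [lt_div_iff₀ (by positivity)] at hN
            linarith
    · simp only [Real.rpow_zero, Finset.sum_const, Finset.card_univ, nsmul_eq_mul, mul_one]; linarith
  obtain ⟨s, hs, hs1⟩ := intermediate_value_Icc' (Nat.cast_nonneg N) hcont.continuousOn hmem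
  refine ⟨s, lt_of_le_of_ne hs.1 ?_, hs1⟩
  rintro rfl
  simp only [Real.rpow_zero, Finset.sum_const, Finset.card_univ, nsmul_eq_mul, mul_one] at hs1; linarith

theorem wt_rpow {ι : Type} {ρ : ι → ℝ} (h : ∀ i, 0 < ρ i) (s : ℝ) (k : List ι) :
    wt (fun i => ρ i ^ s) k = wt ρ k ^ s := by
  induction k with
  | nil => simp [wt]
  | cons a k ih =>
    have h1 : wt ρ (a :: k) = ρ a * wt ρ k := by simp [wt]
    have h2 : wt (fun i => ρ i ^ s) (a :: k) = ρ a ^ s * wt (fun i => ρ i ^ s) k := by simp [wt]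
    rw [h1, h2, ih, Real.mul_rpow (h a).le (wt_pos h k).le]

theorem embeds_of_bil {ι κ : Type} [Fintype ι] [Fintype κ] [Nontrivial ι] [Nontrivial κ] {ρ : ι → ℝ} {τ : κ → ℝ}
    (hρ : ∀ i, 0 < ρ i) (hρ1 : ∀ i, ρ i < 1) (hτ : ∀ i, 0 < τ i) (hτ1 : ∀ i, τ i < 1)
    {h : (ℕ → ι) ≃ (ℕ → κ)} {C : ℝ} (hC : 0 < C) (hB : Bil ρ τ h C) : Embeds ρ τ := by
  classical
  obtain ⟨s, hs, hs1⟩ := exists_dim hτ hτ1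
  have hq : ∀ k, 0 < τ k ^ s := fun k => Real.rpow_pos_of_pos (hτ k) s
  obtain ⟨G, ν, hG, hGU, hνU, hν⟩ := exists_nu (fun k => τ k ^ s) hq hs1
  obtain ⟨K, M, hK, hstr⟩ := structure_lemma hρ hρ1 hτ hτ1 hC hB
  choose w hw1 hw2 hA hA' using hstr
  choose A hAne hAeq using hA
  choose A' hA'ne hA'eq using hA'
  set b : (Fin M → κ) → ℝ := fun u => wt (fun k => τ k ^ s) (List.ofFn u) with hb
  have hb0 : ∀ u, 0 < b u := fun u => wt_pos hq _
  set a : Finset (Fin M → κ) → ℝ := fun A => ∑ u ∈ A, b u with ha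
  have ha0 : ∀ A : Finset (Fin M → κ), A.Nonempty → 0 < a A := fun A hA => Finset.sum_pos (fun u _ => hb0 u) hA
  have haU : ∀ A : Finset (Fin M → κ), a A ≤ a Finset.univ := fun A =>
    Finset.sum_le_sum_of_subset_of_nonneg (Finset.subset_univ A) (fun u _ _ => (hb0 u).le)
  obtain ⟨um, hum⟩ := Finite.exists_min b
  have haL : ∀ A : Finset (Fin M → κ), A.Nonempty → b um ≤ a A := by
    rintro A ⟨u, hu⟩
    exact (hum u).trans (Finset.single_le_sum (f := b) (fun u _ => (hb0 u).le) hu)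
  have hform : ∀ (v : List κ) (B : Finset (Fin M → κ)),
      ν (⋃ u ∈ B, cyl (v ++ List.ofFn u)) = wt τ v ^ s * a B := by
    intro v B
    rw [hνU _ B _ (fun u _ => hG _)]
    · rw [ha, Finset.mul_sum]
      refine Finset.sum_congr rfl fun u _ => ?_
      rw [hν, wt_append, wt_rpow hτ]
    · intro u _ u' _ hne
      refine cyl_disj (by simp) (fun e => hne ?_)
      exact List.ofFn_injective (List.append_cancel_left e)
  set V : List ι → ℝ := fun i => ν (h '' cyl i) with hV
  have hV1 : ∀ i, V i = wt τ (w i) ^ s * a (A i) := fun i => by rw [hV]; simp only; rw [hAeq, hform]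
  have hV2 : ∀ i j, V (i ++ [j]) = wt τ (w i) ^ s * a (A' i j) := fun i j => by
    rw [hV]; simp only; rw [hA'eq, hform]
  have hVG : ∀ i, h '' cyl i ∈ G := fun i => by
    rw [hAeq]; exact hGU _ _ _ (fun u _ => hG _)
  have hVsum : ∀ i, V i = ∑ j, V (i ++ [j]) := by
    intro i
    have : h '' cyl i = ⋃ j ∈ (Finset.univ : Finset ι), h '' cyl (i ++ [j]) := by
      rw [cyl_split i]; simp only [Set.image_iUnion]
    rw [hV]; simp only
    rw [this, hνU _ _ _ (fun j _ => hVG _)]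
    intro j _ j' _ hne
    refine (Set.disjoint_image_iff h.injective).2 (cyl_disj (by simp) (fun e => hne ?_))
    simpa using e
  have hwr : ∀ i, 0 < wt ρ i := wt_pos hρ
  have hwt : ∀ i, 0 < wt τ i := wt_pos hτ
  have hp : ∀ j, 0 < ρ j ^ s := fun k => Real.rpow_pos_of_pos (hρ k) s
  have hwrs : ∀ i, 0 < wt ρ i ^ s := fun i => Real.rpow_pos_of_pos (hwr i) s
  have hwts : ∀ i, 0 < wt τ i ^ s := fun i => Real.rpow_pos_of_pos (hwt i) s
  have hsing : ∀ i j, wt ρ (i ++ [j]) ^ s = wt ρ i ^ s * ρ j ^ s := fun i j => by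
    rw [wt_append, Real.mul_rpow (hwr _).le (hwr _).le]; simp [wt]
  obtain ⟨i0, hi0⟩ := const_of_finite_ratio (fun j => ρ j ^ s) hp (fun i => V i / wt ρ i ^ s)
    (b um) (K ^ s * a Finset.univ) (hb0 um)
    (fun i => by
      rw [le_div_iff₀ (hwrs i), hV1, mul_comm]
      exact mul_le_mul (Real.rpow_le_rpow (hwr i).le (hw1 i) hs.le) (haL _ (hAne i)) (hb0 um).le (hwts _).le)
    (fun i => by
      rw [div_le_iff₀ (hwrs i), hV1]
      have e1 : wt τ (w i) ^ s ≤ K ^ s * wt ρ i ^ s := by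
        rw [← Real.mul_rpow hK.le (hwr i).le]
        exact Real.rpow_le_rpow (hwt _).le (hw2 i) hs.le
      calc _ ≤ (K ^ s * wt ρ i ^ s) * a Finset.univ :=
            mul_le_mul e1 (haU _) (ha0 _ (hAne i)).le ((hwts _).le.trans e1)
        _ = _ := by ring)
    (fun i => by
      rw [hVsum i, Finset.sum_div]
      refine Finset.sum_congr rfl fun j _ => ?_
      rw [hsing]
      have := (hp j).ne'
      have := (hwrs i).ne'
      field_simp)
    (Set.range fun t : (Finset (Fin M → κ) × Finset (Fin M → κ)) × ι => a t.1.1 / a t.1.2 / ρ t.2 ^ s)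
    (Set.finite_range _)
    (fun i j => by
      refine ⟨((A' i j, A i), j), ?_⟩
      simp only
      rw [hV1 i, hV2, hsing]
      have := (hp j).ne'
      have := (hwrs i).ne'
      have := (hwts (w i)).ne'
      have := (ha0 _ (hAne i)).ne'
      field_simp)
  set T0 := V i0 / wt ρ i0 ^ s with hT0
  have hT0pos : 0 < T0 := by
    rw [hT0, hV1]; exact div_pos (mul_pos (hwts _) (ha0 _ (hAne _))) (hwrs _)
  refine ⟨Finset (Fin M → κ), inferInstance, fun B => (a B / (T0 * wt ρ i0 ^ s)) ^ (1 / s),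
    fun k => (w (i0 ++ k), A (i0 ++ k)), ?_, ?_⟩
  · intro k l hkl
    simp only [Prod.mk.injEq] at hkl
    have : h '' cyl (i0 ++ k) = h '' cyl (i0 ++ l) := by
      rw [hAeq, hAeq, hkl.1, hkl.2]
    exact List.append_cancel_left (cyl_inj (h.injective.image_injective this))
  · intro k
    have e := hi0 k
    rw [hV1, div_eq_iff (hwrs _).ne', wt_append, Real.mul_rpow (hwr _).le (hwr _).le] at e
    have hapos := ha0 _ (hAne (i0 ++ k))
    have hne : T0 * wt ρ i0 ^ s ≠ 0 := (mul_pos hT0pos (hwrs _)).ne'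
    have e2 : wt ρ k ^ s = a (A (i0 ++ k)) / (T0 * wt ρ i0 ^ s) * wt τ (w (i0 ++ k)) ^ s := by
      rw [div_mul_eq_mul_div, eq_div_iff hne]; linarith
    have e3 := congrArg (fun x => x ^ (1 / s)) e2
    rw [Real.mul_rpow (div_nonneg hapos.le (mul_pos hT0pos (hwrs _)).le) (hwts _).le,
      ← Real.rpow_mul (hwr _).le, ← Real.rpow_mul (hwt _).le, mul_one_div_cancel hs.ne', Real.rpow_one,
      Real.rpow_one] at e3
    exact e3

theorem stmt8 {d d' m n : ℕ} (hm : 2 ≤ m) (hn : 2 ≤ n)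
    (ρ : Fin m → ℝ) (τ : Fin n → ℝ)
    (hρ : ∀ i, ρ i ∈ Set.Ioo (0 : ℝ) 1) (hτ : ∀ k, τ k ∈ Set.Ioo (0 : ℝ) 1)
    (hρcop : IsCoplanar ρ) (hτcop : IsCoplanar τ)
    (E : Set (EuclideanSpace ℝ (Fin d))) (F : Set (EuclideanSpace ℝ (Fin d')))
    (hE : IsDustLike E ρ) (hF : IsDustLike F τ) :
    LipEquiv E F ↔ ∃ p q : ℕ, 0 < p ∧ 0 < q ∧ iterMS ρ p = iterMS τ q := by
  haveI : Nontrivial (Fin m) := Fin.nontrivial_iff_two_le.2 hm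
  haveI : Nontrivial (Fin n) := Fin.nontrivial_iff_two_le.2 hn
  constructor
  · intro hL
    obtain ⟨h, C, hC, hB⟩ := exists_bil E F ρ τ hE hF hL
    obtain ⟨η, hη⟩ := coplanar_functional ρ hρcop
    obtain ⟨ξ, hξ⟩ := coplanar_functional τ hτcop
    have r0 : ∀ i, 0 < ρ i := fun i => (hρ i).1
    have r1 : ∀ i, ρ i < 1 := fun i => (hρ i).2
    have t0 : ∀ i, 0 < τ i := fun i => (hτ i).1
    have t1 : ∀ i, τ i < 1 := fun i => (hτ i).2
    exact analysis_main hm hn ρ τ r0 t0 η ξ hη hξ (embeds_of_bil r0 r1 t0 t1 hC hB)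
      (embeds_of_bil t0 t1 r0 r1 hC hB.symm)
  · rintro ⟨p, q, hp, hq, h⟩
    exact conv_dir ρ τ E F hE hF p q hp hq h
end
end

section
/- Let s ≥ 2 and let λ_1,…,λ_s ∈ (0,1) have log λ_1,…,log λ_s linearly independent over ℚ. Let a_j, k_j, b_j, ℓ_j (1 ≤ j ≤ s) be positive integers, let ρ be the contraction vector consisting, for each j, of a_j copies of λ_j^{k_j}, and let τ consist, for each j, of b_j copies of λ_j^{ℓ_j}. Let E ⊆ ℝ^d and F ⊆ ℝ^{d'} be dust-like self-similar sets with contraction vectors ρ and τ respectively. Then E and F are Lipschitz equivalent if and only if ρ and τ coincide as multisets (equivalently, a_j = b_j and k_j = ℓ_j for all j). -/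
open scoped BigOperators

noncomputable section

namespace DL

/-- product of weights along the first `n` letters -/
def W {ι : Type} (ρ : ι → ℝ) (x : ℕ → ι) (n : ℕ) : ℝ := ∏ i ∈ Finset.range n, ρ (x i)

/-- agree on the first n letters -/
def Agree {ι : Type} (x y : ℕ → ι) (n : ℕ) : Prop := ∀ i < n, x i = y i

/-- first difference at n -/
def Sep {ι : Type} (x y : ℕ → ι) (n : ℕ) : Prop := (∀ i < n, x i = y i) ∧ x n ≠ y n

lemma exists_sep {ι : Type} {x y : ℕ → ι} (h : x ≠ y) : ∃ n, Sep x y n := by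
  classical
  have h' : ∃ n, x n ≠ y n := Function.ne_iff.mp h
  refine ⟨Nat.find h', ?_, Nat.find_spec h'⟩
  intro i hi
  by_contra hc
  exact Nat.find_min h' hi hc

lemma Sep.symm {ι : Type} {x y : ℕ → ι} {n : ℕ} (h : Sep x y n) : Sep y x n :=
  ⟨fun i hi => (h.1 i hi).symm, h.2.symm⟩

lemma W_succ {ι : Type} (ρ : ι → ℝ) (x : ℕ → ι) (n : ℕ) :
    W ρ x (n+1) = W ρ x n * ρ (x n) := by
  simp [W, Finset.prod_range_succ]

lemma W_zero {ι : Type} (ρ : ι → ℝ) (x : ℕ → ι) : W ρ x 0 = 1 := by simp [W]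

lemma W_pos {ι : Type} {ρ : ι → ℝ} (h : ∀ j, 0 < ρ j) (x : ℕ → ι) (n : ℕ) : 0 < W ρ x n :=
  Finset.prod_pos fun _ _ => h _

lemma W_congr {ι : Type} (ρ : ι → ℝ) {x y : ℕ → ι} {n : ℕ} (h : Agree x y n) :
    W ρ x n = W ρ y n :=
  Finset.prod_congr rfl fun i hi => by rw [h i (Finset.mem_range.mp hi)]

lemma W_anti {ι : Type} {ρ : ι → ℝ} (h0 : ∀ j, 0 < ρ j) (h1 : ∀ j, ρ j ≤ 1) (x : ℕ → ι) :
    Antitone (W ρ x) := by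
  apply antitone_nat_of_succ_le
  intro n
  rw [W_succ]
  exact mul_le_of_le_one_right (W_pos h0 x n).le (h1 _)

lemma W_add_le {ι : Type} {ρ : ι → ℝ} {r : ℝ} (h0 : ∀ j, 0 < ρ j) (h1 : ∀ j, ρ j ≤ r)
    (x : ℕ → ι) (n m : ℕ) : W ρ x (n+m) ≤ W ρ x n * r ^ m := by
  induction m with
  | zero => simp
  | succ m ih =>
    rw [← add_assoc, W_succ, pow_succ, ← mul_assoc]
    have := W_pos h0 x n
    have hr : 0 < r := (h0 (x 0)).trans_le (h1 _)
    exact mul_le_mul ih (h1 _) (h0 _).le (by positivity)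

lemma le_W_add {ι : Type} {ρ : ι → ℝ} {r : ℝ} (hr : 0 < r) (h1 : ∀ j, r ≤ ρ j)
    (x : ℕ → ι) (n m : ℕ) : W ρ x n * r ^ m ≤ W ρ x (n+m) := by
  have h0 : ∀ j, 0 < ρ j := fun j => hr.trans_le (h1 j)
  induction m with
  | zero => simp
  | succ m ih =>
    rw [← add_assoc, W_succ, pow_succ, ← mul_assoc]
    have := W_pos h0 x n
    exact mul_le_mul ih (h1 _) hr.le (W_pos h0 _ _).le

lemma exists_lt_W {ι : Type} [Fintype ι] {ρ : ι → ℝ} (h : ∀ j, ρ j < 1) :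
    ∃ r, 0 < r ∧ r < 1 ∧ ∀ j, ρ j ≤ r := by
  classical
  by_cases hne : Nonempty ι
  · obtain ⟨j, hj⟩ := Finite.exists_max ρ
    refine ⟨max (ρ j) (1/2), by positivity, max_lt (h j) (by norm_num), fun i => (hj i).trans (le_max_left _ _)⟩
  · exact ⟨1/2, by norm_num, by norm_num, fun j => (hne ⟨j⟩).elim⟩

lemma exists_low {ι : Type} [Finite ι] {ρ : ι → ℝ} (h : ∀ j, 0 < ρ j) :
    ∃ r, 0 < r ∧ r ≤ 1 ∧ ∀ j, r ≤ ρ j := by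
  by_cases hne : Nonempty ι
  · obtain ⟨j, hj⟩ := Finite.exists_min ρ
    exact ⟨min (ρ j) 1, lt_min (h j) one_pos, min_le_right _ _, fun i => (min_le_left _ _).trans (hj i)⟩
  · exact ⟨1, one_pos, le_rfl, fun j => (hne ⟨j⟩).elim⟩

lemma coding {d : ℕ} {ι : Type} [Fintype ι] (E : Set (EuclideanSpace ℝ (Fin d))) (ρ : ι → ℝ)
    (hE : IsDustLike E ρ) :
    ∃ (e : E ≃ (ℕ → ι)) (c C : ℝ), 0 < c ∧ 0 < C ∧ ∀ x y n, Sep (e x) (e y) n →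
      c * W ρ (e x) n ≤ dist (x : EuclideanSpace ℝ (Fin d)) y ∧
      dist (x : EuclideanSpace ℝ (Fin d)) y ≤ C * W ρ (e x) n := by
  classical
  obtain ⟨hc, hne, hρ, φ, hφ, hEu, hdisj⟩ := hE
  have hρ0 : ∀ j, 0 < ρ j := fun j => (hρ j).1
  have hex : ∀ x : E, ∃ (j : ι) (y : E), φ j y = (x : EuclideanSpace ℝ (Fin d)) := by
    intro x
    have : (x : EuclideanSpace ℝ (Fin d)) ∈ ⋃ j, φ j '' E := hEu ▸ x.2
    obtain ⟨j, y, hy, hxy⟩ := Set.mem_iUnion.mp this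
    exact ⟨j, ⟨y, hy⟩, hxy⟩
  choose J S hJS using hex
  have hmaps : ∀ j (y : E), φ j y ∈ E := by
    intro j y
    have : φ j y ∈ ⋃ j, φ j '' E := Set.mem_iUnion.mpr ⟨j, y, y.2, rfl⟩
    exact hEu.ge this
  have hinj : ∀ j x y, φ j x = φ j y → x = y := by
    intro j x y h
    have := hφ j x y
    rw [h, dist_self] at this
    have := (mul_eq_zero.mp this.symm).resolve_left (hρ0 j).ne'
    exact dist_eq_zero.mp this
  have hJ : ∀ j (y x : E), φ j y = (x : EuclideanSpace ℝ (Fin d)) → J x = j ∧ S x = y := by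
    intro j y x h
    have h1 : J x = j := by
      by_contra hne
      refine Set.disjoint_left.mp (hdisj hne) ⟨S x, (S x).2, hJS x⟩ ⟨y, y.2, h⟩
    refine ⟨h1, ?_⟩
    apply Subtype.ext
    apply hinj j
    rw [h, ← h1, hJS]
  let code : E → ℕ → ι := fun x n => J (S^[n] x)
  -- scaling
  have hscale : ∀ n (x y : E), Agree (code x) (code y) n →
      dist (x : EuclideanSpace ℝ (Fin d)) y = W ρ (code x) n *
        dist ((S^[n] x : E) : EuclideanSpace ℝ (Fin d)) (S^[n] y : E) := by
    intro n
    induction n with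
    | zero => intro x y _; simp [W]
    | succ n ih =>
      intro x y h
      rw [ih x y (fun i hi => h i (by omega)), W_succ, mul_assoc]
      congr 1
      have hn : code x n = code y n := h n (by omega)
      rw [Function.iterate_succ_apply', Function.iterate_succ_apply', ← hφ]
      conv_lhs => rw [← hJS (S^[n] x), ← hJS (S^[n] y)]
      change dist (φ (code x n) _) (φ (code y n) _) = _
      rw [hn]
  -- distances
  obtain ⟨δ, hδ, hδ'⟩ : ∃ δ : ℝ, 0 < δ ∧ ∀ x y : E, J x ≠ J y →
      δ ≤ dist (x : EuclideanSpace ℝ (Fin d)) y := by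
    have hcomp : ∀ j, IsCompact (φ j '' E) := by
      intro j
      apply hc.image
      have : LipschitzWith (ρ j).toNNReal (φ j) := by
        apply LipschitzWith.of_dist_le_mul
        intro x y
        rw [hφ, Real.coe_toNNReal _ (hρ0 j).le]
      exact this.continuous
    have hpair : ∀ p : ι × ι, ∃ δ : ℝ, 0 < δ ∧ (p.1 ≠ p.2 → ∀ x ∈ φ p.1 '' E, ∀ y ∈ φ p.2 '' E,
        δ ≤ dist x y) := by
      intro p
      by_cases hp : p.1 = p.2
      · exact ⟨1, one_pos, fun h => (h hp).elim⟩
      · obtain ⟨r, hr, h⟩ := Metric.exists_pos_forall_lt_edist (hcomp p.1) (hcomp p.2).isClosed (hdisj hp)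
        refine ⟨r, by exact_mod_cast hr, fun _ x hx y hy => ?_⟩
        have := h x hx y hy
        rw [edist_nndist] at this
        have h2 : r < nndist x y := by exact_mod_cast this
        rw [← coe_nndist]
        exact_mod_cast h2.le
    choose D hD0 hD using hpair
    obtain ⟨r, hr, -, hr'⟩ := exists_low hD0
    refine ⟨r, hr, fun x y hxy => (hr' (J x, J y)).trans ?_⟩
    exact hD (J x, J y) hxy _ ⟨S x, (S x).2, hJS x⟩ _ ⟨S y, (S y).2, hJS y⟩
  obtain ⟨C, hC0, hC⟩ : ∃ C : ℝ, 0 < C ∧ ∀ x y : E, dist (x : EuclideanSpace ℝ (Fin d)) y ≤ C := by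
    refine ⟨Metric.diam E + 1, by positivity, fun x y => ?_⟩
    have := Metric.dist_le_diam_of_mem hc.isBounded x.2 y.2
    linarith
  have hcinj : Function.Injective code := by
    intro x y h
    obtain ⟨r, hr0, hr1, hr⟩ := exists_lt_W (fun j => (hρ j).2)
    apply Subtype.ext
    apply dist_eq_zero.mp
    apply le_antisymm _ dist_nonneg
    have hb : ∀ n, dist (x : EuclideanSpace ℝ (Fin d)) y ≤ r ^ n * C := by
      intro n
      rw [hscale n x y (fun i _ => by rw [h])]
      refine mul_le_mul ?_ (hC _ _) dist_nonneg (by positivity)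
      have := W_add_le hρ0 hr (code x) 0 n
      simpa [W_zero] using this
    have ht : Filter.Tendsto (fun n => r ^ n * C) Filter.atTop (nhds 0) := by
      simpa using (tendsto_pow_atTop_nhds_zero_of_lt_one hr0.le hr1).mul_const C
    exact ge_of_tendsto' ht hb
  have hcsurj : Function.Surjective code := by
    intro z
    -- cylinder sets as closed subsets of E
    let K : (ℕ → ι) → ℕ → Set (EuclideanSpace ℝ (Fin d)) := fun z n =>
      Nat.rec (motive := fun _ => (ℕ → ι) → Set (EuclideanSpace ℝ (Fin d))) (fun _ => E)
        (fun _ ih z => φ (z 0) '' ih (fun i => z (i+1))) n z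
    have hK0 : ∀ z, K z 0 = E := fun z => rfl
    have hKs : ∀ z n, K z (n+1) = φ (z 0) '' K (fun i => z (i+1)) n := fun z n => rfl
    have hcont : ∀ j, Continuous (φ j) := by
      intro j
      have : LipschitzWith (ρ j).toNNReal (φ j) := by
        apply LipschitzWith.of_dist_le_mul
        intro x y
        rw [hφ, Real.coe_toNNReal _ (hρ0 j).le]
      exact this.continuous
    have hKc : ∀ n z, IsCompact (K z n) := by
      intro n
      induction n with
      | zero => intro z; exact hc
      | succ n ih => intro z; rw [hKs]; exact (ih _).image (hcont _)
    have hKn : ∀ n z, (K z n).Nonempty := by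
      intro n
      induction n with
      | zero => intro z; exact hne
      | succ n ih => intro z; rw [hKs]; exact (ih _).image _
    have hKa : ∀ n z, K z (n+1) ⊆ K z n := by
      intro n
      induction n with
      | zero =>
        intro z
        rw [hKs, hK0, hK0]
        rintro _ ⟨y, hy, rfl⟩
        exact hmaps _ ⟨y, hy⟩
      | succ n ih => intro z; rw [hKs z (n+1), hKs z n]; exact Set.image_mono (ih (fun i => z (i+1)))
    have hKcode : ∀ n z (x : E), (x : EuclideanSpace ℝ (Fin d)) ∈ K z n → ∀ i < n, code x i = z i := by
      intro n
      induction n with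
      | zero => intro z x _ i hi; omega
      | succ n ih =>
        intro z x hx i hi
        rw [hKs] at hx
        obtain ⟨y, hy, hyx⟩ := hx
        have hKE : ∀ n z, K z n ⊆ E := by
          intro n z
          induction n with
          | zero => exact subset_rfl
          | succ n ih => exact (hKa n z).trans ih
        have hyE := hKE _ _ hy
        obtain ⟨h1, h2⟩ := hJ (z 0) ⟨y, hyE⟩ x hyx
        cases i with
        | zero => exact h1
        | succ i =>
          have := ih _ ⟨y, hyE⟩ hy i (by omega)
          change J (S^[i+1] x) = _
          rw [Function.iterate_succ_apply, h2]
          exact this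
    obtain ⟨x, hx⟩ := IsCompact.nonempty_iInter_of_sequence_nonempty_isCompact_isClosed (K z)
      (fun n => hKa n z) (fun n => hKn n z) (hKc 0 z) (fun n => (hKc n z).isClosed)
    have hx' := Set.mem_iInter.mp hx
    refine ⟨⟨x, hx' 0⟩, ?_⟩
    funext i
    exact hKcode (i+1) z ⟨x, hx' 0⟩ (hx' (i+1)) i (by omega)
  refine ⟨Equiv.ofBijective code ⟨hcinj, hcsurj⟩, δ, C, hδ, hC0, ?_⟩
  intro x y n hs
  change Sep (code x) (code y) n at hs
  change δ * W ρ (code x) n ≤ _ ∧ _ ≤ C * W ρ (code x) n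
  rw [hscale n x y hs.1]
  have hW := W_pos hρ0 (code x) n
  constructor
  · rw [mul_comm]; gcongr; exact hδ' _ _ hs.2
  · rw [mul_comm]; gcongr; exact hC _ _

/-- symbolic bilipschitz equivalence -/
def SymBL {ι κ : Type} (ρ : ι → ℝ) (τ : κ → ℝ) (g : (ℕ → ι) ≃ (ℕ → κ)) : Prop :=
  ∃ c C : ℝ, 0 < c ∧ 0 < C ∧ ∀ x y n m, Sep x y n → Sep (g x) (g y) m →
    c * W ρ x n ≤ W τ (g x) m ∧ W τ (g x) m ≤ C * W ρ x n

lemma SymBL.symm {ι κ : Type} {ρ : ι → ℝ} {τ : κ → ℝ} {g : (ℕ → ι) ≃ (ℕ → κ)}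
    (h : SymBL ρ τ g) : SymBL τ ρ g.symm := by
  obtain ⟨c, C, hc, hC, h⟩ := h
  refine ⟨C⁻¹, c⁻¹, by positivity, by positivity, fun x y n m hs hs' => ?_⟩
  have := h (g.symm x) (g.symm y) m n hs' (by simpa using hs)
  rw [g.apply_symm_apply] at this
  constructor
  · rw [inv_mul_le_iff₀ hC]; exact this.2
  · rw [le_inv_mul_iff₀ hc]; exact this.1

lemma symBL_of_lipEquiv {d d' : ℕ} {ι κ : Type} [Fintype ι] [Fintype κ]
    {E : Set (EuclideanSpace ℝ (Fin d))} {F : Set (EuclideanSpace ℝ (Fin d'))}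
    {ρ : ι → ℝ} {τ : κ → ℝ} (hE : IsDustLike E ρ) (hF : IsDustLike F τ) (h : LipEquiv E F) :
    ∃ g : (ℕ → ι) ≃ (ℕ → κ), SymBL ρ τ g := by
  obtain ⟨e, c, C, hc, hC, he⟩ := coding E ρ hE
  obtain ⟨e', c', C', hc', hC', he'⟩ := coding F τ hF
  obtain ⟨f, hf, A, hA, hfA⟩ := h
  refine ⟨e.symm.trans ((Equiv.ofBijective f hf).trans e'), A⁻¹ * c / C', A * C / c', by positivity, by positivity, ?_⟩
  intro x y n m hs hs'
  have h1 := he (e.symm x) (e.symm y) n (by simpa using hs)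
  have h2 := he' (f (e.symm x)) (f (e.symm y)) m hs'
  have h3 := hfA (e.symm x) (e.symm y)
  rw [e.apply_symm_apply] at h1
  change _ ≤ W τ (e' (f (e.symm x))) m ∧ W τ (e' (f (e.symm x))) m ≤ _
  constructor
  · rw [div_mul_eq_mul_div, div_le_iff₀ hC']
    calc A⁻¹ * c * W ρ x n = A⁻¹ * (c * W ρ x n) := by ring
      _ ≤ A⁻¹ * dist (e.symm x : EuclideanSpace ℝ (Fin d)) (e.symm y) := by gcongr; exact h1.1
      _ ≤ _ := h3.1
      _ ≤ _ := h2.2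
      _ = _ := by ring
  · rw [div_mul_eq_mul_div, le_div_iff₀ hc']
    calc _ = c' * W τ (e' (f (e.symm x))) m := by ring
      _ ≤ _ := h2.1
      _ ≤ _ := h3.2
      _ ≤ A * (C * W ρ x n) := by gcongr; exact h1.2
      _ = _ := by ring

lemma lipEquiv_of_same {d d' : ℕ} {ι : Type} [Fintype ι]
    {E : Set (EuclideanSpace ℝ (Fin d))} {F : Set (EuclideanSpace ℝ (Fin d'))}
    {ρ : ι → ℝ} (hE : IsDustLike E ρ) (hF : IsDustLike F ρ) : LipEquiv E F := by
  obtain ⟨e, c, C, hc, hC, he⟩ := coding E ρ hE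
  obtain ⟨e', c', C', hc', hC', he'⟩ := coding F ρ hF
  refine ⟨e.trans e'.symm, (e.trans e'.symm).bijective, C / c' + C' / c, by positivity, fun x y => ?_⟩
  by_cases hxy : x = y
  · subst hxy; simp
  obtain ⟨n, hn⟩ := exists_sep (e.injective.ne hxy)
  have h1 := he x y n hn
  have h2 := he' (e'.symm (e x)) (e'.symm (e y)) n (by simpa using hn)
  rw [e'.apply_symm_apply] at h2
  have hW : 0 < W ρ (e x) n := W_pos (fun j => (hE.2.2.1 j).1) _ _
  change _ ≤ dist ((e'.symm (e x) : F) : EuclideanSpace ℝ (Fin d')) (e'.symm (e y)) ∧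
    dist ((e'.symm (e x) : F) : EuclideanSpace ℝ (Fin d')) (e'.symm (e y)) ≤ _
  constructor
  · rw [inv_mul_le_iff₀ (by positivity)]
    calc _ ≤ _ := h1.2
      _ = (C / c') * (c' * W ρ (e x) n) := by field_simp
      _ ≤ (C / c' + C' / c) * (c' * W ρ (e x) n) := by gcongr; simp; positivity
      _ ≤ _ := by gcongr; exact h2.1
  · calc _ ≤ _ := h2.2
      _ = (C' / c) * (c * W ρ (e x) n) := by field_simp
      _ ≤ (C / c' + C' / c) * (c * W ρ (e x) n) := by gcongr; simp; positivity
      _ ≤ _ := by gcongr; exact h1.1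


lemma sep_le_of_agree {ι : Type} {x y : ℕ → ι} {n m : ℕ} (h : Sep x y n) (h' : Agree x y m) :
    m ≤ n := by
  by_contra hc
  exact h.2 (h' n (by omega))

lemma window {ι κ : Type} [Fintype ι] [Fintype κ] {ρ : ι → ℝ} {τ : κ → ℝ}
    (hρ : ∀ j, ρ j ∈ Set.Ioo (0:ℝ) 1) (hτ : ∀ j, τ j ∈ Set.Ioo (0:ℝ) 1)
    {g : (ℕ → ι) ≃ (ℕ → κ)} (hg : SymBL ρ τ g) :
    ∃ (K : ℕ) (c C : ℝ), 0 < c ∧ 0 < C ∧ ∀ x n, ∃ m,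
      (∀ y, Agree x y n → Agree (g x) (g y) m) ∧
      (∀ y z, Agree x y n → Agree (g y) (g z) (m+K) → Agree y z (n+1)) ∧
      c * W ρ x n ≤ W τ (g x) m ∧ W τ (g x) m ≤ C * W ρ x n := by
  classical
  obtain ⟨c, C, hc, hC, h⟩ := hg
  have hρ0 : ∀ j, 0 < ρ j := fun j => (hρ j).1
  have hτ0 : ∀ j, 0 < τ j := fun j => (hτ j).1
  obtain ⟨r, hr0, hr1, hr⟩ := exists_lt_W (fun j => (hτ j).2)
  obtain ⟨q, hq0, hq1, hq⟩ := exists_low hτ0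
  obtain ⟨K, hK⟩ := exists_pow_lt_of_lt_one (show 0 < c * q / C by positivity) hr1
  refine ⟨K, min 1 C, C / q, by positivity, by positivity, fun x n => ?_⟩
  have hR := W_pos hρ0 x n
  set R := W ρ x n with hRdef
  have hR1 : R ≤ 1 := by
    have := W_anti hρ0 (fun j => (hρ j).2.le) x (Nat.zero_le n)
    simpa [W_zero] using this
  have hex : ∃ m, W τ (g x) (m+1) ≤ C * R := by
    obtain ⟨m, hm⟩ := exists_pow_lt_of_lt_one (show 0 < C * R by positivity) hr1
    refine ⟨m, ?_⟩
    have h1 := W_add_le hτ0 hr (g x) 0 m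
    rw [W_zero, one_mul, zero_add] at h1
    exact ((W_anti hτ0 (fun j => (hτ j).2.le) (g x) (Nat.le_succ m)).trans h1).trans hm.le
  set m := Nat.find hex with hm
  have hm1 : W τ (g x) (m+1) ≤ C * R := Nat.find_spec hex
  have hm2 : ∀ t < m, C * R < W τ (g x) (t+1) := fun t ht => not_le.mp (Nat.find_min hex ht)
  have hup : W τ (g x) m ≤ C / q * R := by
    rw [W_succ] at hm1
    rw [div_mul_eq_mul_div, le_div_iff₀ hq0]
    refine le_trans ?_ hm1
    have := W_pos hτ0 (g x) m
    gcongr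
    exact hq _
  have A1 : ∀ y, Agree x y n → Agree (g x) (g y) m := by
    intro y hy
    by_cases hxy : x = y
    · subst hxy; intro i _; rfl
    obtain ⟨n', hn'⟩ := exists_sep hxy
    obtain ⟨m', hm'⟩ := exists_sep (g.injective.ne hxy)
    have h1 := (h x y n' m' hn' hm').2
    have h2 : W ρ x n' ≤ R := W_anti hρ0 (fun j => (hρ j).2.le) x (sep_le_of_agree hn' hy)
    have h3 : W τ (g x) m' ≤ C * R := h1.trans (by gcongr)
    have : m ≤ m' := by
      by_contra hlt
      push Not at hlt
      cases m' with
      | zero =>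
        have := hm2 0 hlt
        have h4 := W_anti hτ0 (fun j => (hτ j).2.le) (g x) (Nat.zero_le (0+1))
        linarith
      | succ t =>
        have := hm2 t (by omega)
        linarith
    intro i hi
    exact hm'.1 i (by omega)
  refine ⟨m, A1, ?_, ?_, hup⟩
  · intro y z hxy hyz
    by_cases hyz' : y = z
    · subst hyz'; intro i _; rfl
    obtain ⟨n', hn'⟩ := exists_sep hyz'
    obtain ⟨m', hm'⟩ := exists_sep (g.injective.ne hyz')
    have h1 := (h y z n' m' hn' hm').1
    have hle := sep_le_of_agree hm' hyz
    by_cases hnn : n < n'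
    · intro i hi; exact hn'.1 i (by omega)
    exfalso
    have h2 : R ≤ W ρ y n' := by
      rw [hRdef, W_congr ρ hxy]
      exact W_anti hρ0 (fun j => (hρ j).2.le) y (by omega)
    have h3 : W τ (g y) m' ≤ W τ (g y) m * r ^ K :=
      (W_anti hτ0 (fun j => (hτ j).2.le) (g y) hle).trans (W_add_le hτ0 hr _ _ _)
    rw [← W_congr τ (A1 y hxy)] at h3
    have h4 : W τ (g x) m * r ^ K ≤ C / q * R * r ^ K := by gcongr
    have h5 : C / q * R * r ^ K < C / q * R * (c * q / C) := by gcongr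
    have h6 : C / q * R * (c * q / C) = c * R := by field_simp
    have h7 : c * R ≤ c * W ρ y n' := by gcongr
    linarith
  · rcases Nat.eq_zero_or_pos m with h0 | hpos
    · rw [h0, W_zero]
      have : min 1 C * R ≤ 1 * 1 := by
        gcongr
        exact min_le_left _ _
      linarith
    · have := hm2 (m-1) (by omega)
      rw [Nat.sub_add_cancel hpos] at this
      have h1 : min 1 C * R ≤ C * R := by gcongr; exact min_le_right _ _
      linarith

/-- saturated at level M -/
def Satur {κ : Type} (A : Set (ℕ → κ)) (M : ℕ) : Prop := ∀ z z', Agree z z' M → z ∈ A → z' ∈ A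

/-- sums of word weights over a set of words of length K -/
def theta {κ : Type} (q : κ → ℝ) {K : ℕ} (S : Finset (Fin K → κ)) : ℝ :=
  ∑ u ∈ S, ∏ i, q (u i)

/-- replace the window [m, m+K) of z by u -/
def glue {κ : Type} (z : ℕ → κ) (m : ℕ) {K : ℕ} (u : Fin K → κ) : ℕ → κ :=
  fun i => if h : m ≤ i ∧ i - m < K then u ⟨i - m, h.2⟩ else z i

lemma glue_lt {κ : Type} (z : ℕ → κ) {m : ℕ} {K : ℕ} (u : Fin K → κ) {i : ℕ} (h : i < m) :
    glue z m u i = z i := by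
  unfold glue; rw [dif_neg]; omega

lemma glue_add {κ : Type} (z : ℕ → κ) (m : ℕ) {K : ℕ} (u : Fin K → κ) (i : Fin K) :
    glue z m u (m + i) = u i := by
  unfold glue
  rw [dif_pos ⟨by omega, by have := i.2; omega⟩]
  congr 1
  ext
  simp

lemma agree_glue {κ : Type} (z : ℕ → κ) (m : ℕ) {K : ℕ} (u : Fin K → κ) :
    Agree z (glue z m u) m := fun _ hi => (glue_lt z u hi).symm

lemma W_glue {κ : Type} (q : κ → ℝ) (z : ℕ → κ) (m : ℕ) {K : ℕ} (u : Fin K → κ) :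
    W q (glue z m u) (m + K) = W q z m * ∏ i, q (u i) := by
  unfold W
  rw [Finset.prod_range_add]
  congr 1
  · exact Finset.prod_congr rfl fun i hi => by rw [glue_lt _ _ (Finset.mem_range.mp hi)]
  · rw [Finset.prod_range]
    exact Finset.prod_congr rfl fun i _ => by rw [glue_add]

open MeasureTheory in
lemma exists_content {κ : Type} [Fintype κ] (q : κ → ℝ) (hq : ∀ j, 0 < q j) (hq1 : ∑ j, q j = 1) :
    ∃ H : Set (ℕ → κ) → ℝ,
      (∀ (z : ℕ → κ) (m K : ℕ) (A : Set (ℕ → κ)), (∀ y ∈ A, Agree z y m) → Satur A (m+K) →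
        ∃ S : Finset (Fin K → κ), (A.Nonempty → S.Nonempty) ∧ H A = W q z m * theta q S) ∧
      (∀ {α : Type} [Fintype α] (B : α → Set (ℕ → κ)) (M : ℕ), (∀ i, Satur (B i) M) →
        Pairwise (fun i j => Disjoint (B i) (B j)) → H (⋃ i, B i) = ∑ i, H (B i)) := by
  classical
  let _ : MeasurableSpace κ := ⊤
  have : DiscreteMeasurableSpace κ := ⟨fun _ => trivial⟩
  let P : PMF κ := PMF.ofFintype (fun k => ENNReal.ofReal (q k)) (by
    rw [← ENNReal.ofReal_sum_of_nonneg (fun i _ => (hq i).le), hq1, ENNReal.ofReal_one])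
  let ν : Measure (ℕ → κ) := Measure.infinitePi (fun _ => P.toMeasure)
  have hmeas : ∀ (A : Set (ℕ → κ)) M, Satur A M → MeasurableSet A := by
    intro A M hA
    let r : (ℕ → κ) → (Fin M → κ) := fun z i => z i
    have hr : Measurable r := by fun_prop
    have : A = r ⁻¹' (r '' A) := by
      apply Set.Subset.antisymm (Set.subset_preimage_image _ _)
      rintro z ⟨y, hy, hyz⟩
      exact hA y z (fun i hi => congrFun hyz ⟨i, hi⟩) hy
    rw [this]
    exact hr (Set.toFinite _).measurableSet
  have hcyl : ∀ (z : ℕ → κ) n, ν.real {y | Agree z y n} = W q z n := by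
    intro z n
    have : {y | Agree z y n} = Set.pi (Finset.range n) (fun i => {z i}) := by
      ext y
      simp [Agree, Set.mem_pi, eq_comm]
    rw [this, Measure.real, Measure.infinitePi_pi _ (fun i _ => MeasurableSet.singleton _), ENNReal.toReal_prod]
    refine Finset.prod_congr rfl fun i _ => ?_
    rw [PMF.toMeasure_apply_singleton _ _ (MeasurableSet.singleton _)]
    simp [P, ENNReal.toReal_ofReal (hq _).le]
  have hsatcyl : ∀ (z : ℕ → κ) n, Satur {y | Agree z y n} n := by
    intro z n a b hab ha i hi
    rw [ha i hi, hab i hi]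
  refine ⟨fun A => ν.real A, ?_, ?_⟩
  · intro z m K A hA hsat
    refine ⟨Finset.univ.filter (fun u => glue z m u ∈ A), ?_⟩
    have hAe : A = ⋃ u ∈ Finset.univ.filter (fun u : Fin K → κ => glue z m u ∈ A), {y | Agree (glue z m u) y (m+K)} := by
      ext y
      simp only [Finset.mem_filter, Finset.mem_univ, true_and, Set.mem_iUnion, Set.mem_ofPred_eq, exists_prop]
      constructor
      · intro hy
        have : Agree (glue z m (fun i : Fin K => y (m+i))) y (m+K) := by
          intro i hi
          by_cases him : i < m
          · rw [glue_lt _ _ him, hA y hy i him]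
          · have := glue_add z m (fun i : Fin K => y (m+i)) ⟨i-m, by omega⟩
            simp only at this
            rwa [Nat.add_sub_cancel' (by omega)] at this
        exact ⟨_, hsat _ _ (fun i hi => (this i hi).symm) hy, this⟩
      · rintro ⟨u, hu, huy⟩
        exact hsat _ _ huy hu
    constructor
    · rintro ⟨y, hy⟩
      rw [hAe] at hy
      obtain ⟨u, hu⟩ := Set.mem_iUnion.mp hy
      obtain ⟨hu, -⟩ := Set.mem_iUnion.mp hu
      exact ⟨u, hu⟩
    change ν.real A = _
    conv_lhs => rw [hAe]
    rw [measureReal_biUnion_finset, theta, Finset.mul_sum]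
    · exact Finset.sum_congr rfl fun u _ => by rw [hcyl, W_glue]
    · intro u _ v _ huv
      refine Set.disjoint_left.mpr fun y hy hy' => huv ?_
      funext i
      have h1 := hy (m+i) (by omega)
      have h2 := hy' (m+i) (by omega)
      rw [glue_add] at h1 h2
      rw [h1, h2]
    · intro u _
      exact hmeas _ _ (hsatcyl _ _)
  · intro α _ B M hB hd
    have := measureReal_biUnion_finset (μ := ν) (s := Finset.univ) (f := B)
      (fun i _ j _ hij => hd hij) (fun i _ => hmeas _ _ (hB i))
    simpa using this


lemma exists_dim {κ : Type} [Fintype κ] (τ : κ → ℝ) (hτ : ∀ j, τ j ∈ Set.Ioo (0:ℝ) 1)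
    (hcard : 2 ≤ Fintype.card κ) : ∃ D : ℝ, 0 < D ∧ ∑ j, τ j ^ D = 1 := by
  have hcont : Continuous (fun D : ℝ => ∑ j, τ j ^ D) := by
    apply continuous_finsetSum
    intro j _
    exact Real.continuous_const_rpow (hτ j).1.ne'
  have hlim : Filter.Tendsto (fun D : ℝ => ∑ j, τ j ^ D) Filter.atTop (nhds (∑ j : κ, 0)) := by
    apply tendsto_finsetSum
    intro j _
    exact tendsto_rpow_atTop_of_base_lt_one _ (by linarith [(hτ j).1]) (hτ j).2
  rw [Finset.sum_const_zero] at hlim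
  obtain ⟨N, hN, hN0⟩ := ((hlim.eventually (gt_mem_nhds one_pos)).and (Filter.eventually_ge_atTop 0)).exists
  have h0 : ∑ j, τ j ^ (0:ℝ) = (Fintype.card κ : ℝ) := by simp
  have h2 : (2:ℝ) ≤ Fintype.card κ := by exact_mod_cast hcard
  obtain ⟨D, hD, hD1⟩ := intermediate_value_Icc' hN0 hcont.continuousOn
    (show (1:ℝ) ∈ Set.Icc _ _ from ⟨hN.le, by rw [h0]; linarith⟩)
  refine ⟨D, lt_of_le_of_ne hD.1 ?_, hD1⟩
  rintro rfl
  change ∑ j, τ j ^ (0:ℝ) = 1 at hD1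
  rw [h0] at hD1
  linarith

lemma rig_abs {ι X : Type} [Fintype ι] [Nonempty X] (p : ι → ℝ) (hp : ∀ i, 0 < p i)
    (ch : X → ι → X) (h : X → ℝ) (c C : ℝ) (hc : 0 < c) (hlow : ∀ x, c ≤ h x) (hup : ∀ x, h x ≤ C)
    (hsum : ∀ x, h x = ∑ i, p i * h (ch x i)) (Q : Set ℝ) (hQ : Q.Finite)
    (hratio : ∀ x i, h (ch x i) / h x ∈ Q) :
    ∃ x0, ∀ x i, h x = h x0 → h (ch x i) = h x0 := by
  classical
  have hpos : ∀ x, 0 < h x := fun x => hc.trans_le (hlow x)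
  have hba : BddAbove (Set.range h) := ⟨C, by rintro _ ⟨x, rfl⟩; exact hup x⟩
  have hbb : BddBelow (Set.range h) := ⟨c, by rintro _ ⟨x, rfl⟩; exact hlow x⟩
  have hM : ∀ x, h x ≤ ⨆ x, h x := fun x => le_ciSup hba x
  have hm : ∀ x, ⨅ x, h x ≤ h x := fun x => ciInf_le hbb x
  have hm0 : 0 < ⨅ x, h x := hc.trans_le (le_ciInf hlow)
  have hM0 : 0 < ⨆ x, h x := (hpos (Classical.arbitrary X)).trans_le (hM _)
  set M := ⨆ x, h x with hMd
  set m := ⨅ x, h x with hmd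
  have hσ : ∑ i, p i = 1 := by
    apply le_antisymm
    · have : (∑ i, p i) * m ≤ m := by
        apply le_ciInf
        intro x
        rw [hsum x, Finset.sum_mul]
        exact Finset.sum_le_sum fun i _ => mul_le_mul_of_nonneg_left (hm _) (hp i).le
      nlinarith
    · have : M ≤ (∑ i, p i) * M := by
        apply ciSup_le
        intro x
        rw [hsum x, Finset.sum_mul]
        exact Finset.sum_le_sum fun i _ => mul_le_mul_of_nonneg_left (hM _) (hp i).le
      nlinarith
  obtain ⟨ε, hε1, hε⟩ : ∃ ε : ℝ, 1 < ε ∧ ∀ r ∈ Q, 1 < r → ε ≤ r := by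
    have hQ' : (Q ∩ Set.Ioi 1).Finite := hQ.inter_of_left _
    rcases (Q ∩ Set.Ioi 1).eq_empty_or_nonempty with he | hne
    · refine ⟨2, by norm_num, fun r hr h1 => ?_⟩
      have : r ∈ Q ∩ Set.Ioi 1 := ⟨hr, h1⟩
      rw [he] at this
      exact this.elim
    · obtain ⟨a, ha, hmin⟩ := Set.exists_min_image _ id hQ' hne
      exact ⟨a, ha.2, fun r hr h1 => hmin r ⟨hr, h1⟩⟩
  obtain ⟨x0, hx0⟩ : ∃ x0, M / ε < h x0 := by
    apply exists_lt_of_lt_ciSup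
    exact div_lt_self hM0 hε1
  refine ⟨x0, fun x i hx => ?_⟩
  have hle : ∀ i, h (ch x i) ≤ h x := by
    intro i
    by_contra hlt
    push Not at hlt
    have h1 := hε _ (hratio x i) ((one_lt_div (hpos x)).mpr hlt)
    rw [le_div_iff₀ (hpos x), hx] at h1
    rw [div_lt_iff₀ (by linarith)] at hx0
    have := hM (ch x i)
    linarith
  have hs : ∑ i, p i * h (ch x i) = ∑ i, p i * h x := by
    rw [← hsum, ← Finset.sum_mul, hσ, one_mul]
  have := (Finset.sum_eq_sum_iff_of_le (fun i _ => mul_le_mul_of_nonneg_left (hle i) (hp i).le)).mp hs i (Finset.mem_univ i)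
  rw [← hx]
  exact mul_left_cancel₀ (hp i).ne' this

lemma W_rpow {ι : Type} {ρ : ι → ℝ} (hρ : ∀ j, 0 < ρ j) (D : ℝ) (x : ℕ → ι) (n : ℕ) :
    W (fun j => ρ j ^ D) x n = W ρ x n ^ D :=
  Real.finsetProd_rpow _ _ (fun i _ => (hρ _).le) _

lemma theta_pos {κ : Type} {q : κ → ℝ} (hq : ∀ j, 0 < q j) {K : ℕ} {S : Finset (Fin K → κ)}
    (hS : S.Nonempty) : 0 < theta q S :=
  Finset.sum_pos (fun _ _ => Finset.prod_pos fun _ _ => hq _) hS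

lemma rigid {ι κ : Type} [Fintype ι] [Fintype κ] [Nonempty ι] {ρ : ι → ℝ} {τ : κ → ℝ}
    (hρ : ∀ j, ρ j ∈ Set.Ioo (0:ℝ) 1) (hτ : ∀ j, τ j ∈ Set.Ioo (0:ℝ) 1)
    {g : (ℕ → ι) ≃ (ℕ → κ)} (hg : SymBL ρ τ g) (D : ℝ) (hD : 0 < D) (hD1 : ∑ j, τ j ^ D = 1) :
    ∃ (K : ℕ) (Θ : Set ℝ) (x0 : ℕ → ι) (n0 : ℕ), Θ.Finite ∧ (∀ θ ∈ Θ, 0 < θ) ∧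
      ∀ y n, Agree x0 y n0 → n0 ≤ n → ∃ m, ∃ θ ∈ Θ,
        W ρ y n ^ D = W τ (g y) m ^ D * θ ∧ (∀ z, Agree (g y) (g z) (m+K) → Agree y z n) := by
  classical
  have hρ0 : ∀ j, 0 < ρ j := fun j => (hρ j).1
  have hτ0 : ∀ j, 0 < τ j := fun j => (hτ j).1
  obtain ⟨K, c, C, hc, hC, hwin⟩ := window hρ hτ hg
  choose m hm1 hm2 hm3 hm4 using hwin
  set q : κ → ℝ := fun j => τ j ^ D with hq
  set p : ι → ℝ := fun j => ρ j ^ D with hp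
  have hq0 : ∀ j, 0 < q j := fun j => Real.rpow_pos_of_pos (hτ0 j) D
  have hp0 : ∀ j, 0 < p j := fun j => Real.rpow_pos_of_pos (hρ0 j) D
  obtain ⟨H, hH1, hH2⟩ := exists_content q hq0 hD1
  let cyl : (ℕ → ι) → ℕ → Set (ℕ → κ) := fun x n => g '' {y | Agree x y n}
  let Θ : Set ℝ := (fun S : Finset (Fin K → κ) => theta q S) '' {S | S.Nonempty}
  have hΘ : Θ.Finite := (Set.toFinite _).image _
  have hΘ0 : ∀ θ ∈ Θ, 0 < θ := by
    rintro _ ⟨S, hS, rfl⟩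
    exact theta_pos hq0 hS
  have hcne : ∀ x n, (cyl x n).Nonempty := fun x n => ⟨g x, x, fun _ _ => rfl, rfl⟩
  have hsat1 : ∀ x y n, Agree x y n → Satur (cyl y (n+1)) (m x n + K) := by
    rintro x y n hxy _ z' hz ⟨a, ha, rfl⟩
    refine ⟨g.symm z', ?_, g.apply_symm_apply _⟩
    have ha' : Agree y a (n+1) := ha
    have := hm2 x n a (g.symm z') (fun i hi => (hxy i hi).trans (ha' i (by omega))) (by simpa using hz)
    exact fun i hi => (ha' i hi).trans (this i hi)
  have hsat0 : ∀ x n, Satur (cyl x n) (m x n + K) := by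
    rintro x n _ z' hz ⟨a, ha, rfl⟩
    refine ⟨g.symm z', ?_, g.apply_symm_apply _⟩
    have ha' : Agree x a n := ha
    have := hm2 x n a (g.symm z') ha' (by simpa using hz)
    exact fun i hi => (ha' i hi).trans (this i (by omega))
  have F0 : ∀ x n, ∃ θ ∈ Θ, H (cyl x n) = W q (g x) (m x n) * θ := by
    intro x n
    obtain ⟨S, hS, hS'⟩ := hH1 (g x) (m x n) K (cyl x n) (by
      rintro _ ⟨a, ha, rfl⟩
      exact hm1 x n a ha) (hsat0 x n)
    exact ⟨_, ⟨S, hS (hcne _ _), rfl⟩, hS'⟩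
  have F1 : ∀ x y n, Agree x y n → ∃ θ ∈ Θ, H (cyl y (n+1)) = W q (g x) (m x n) * θ := by
    intro x y n hxy
    obtain ⟨S, hS, hS'⟩ := hH1 (g x) (m x n) K (cyl y (n+1)) (by
      rintro _ ⟨a, ha, rfl⟩
      have ha' : Agree y a (n+1) := ha
      exact hm1 x n a (fun i hi => (hxy i hi).trans (ha' i (by omega)))) (hsat1 x y n hxy)
    exact ⟨_, ⟨S, hS (hcne _ _), rfl⟩, hS'⟩
  have hup : ∀ x n (i : ι), Agree x (Function.update x n i) n := by
    intro x n i j hj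
    rw [Function.update_of_ne (by omega)]
  have F2 : ∀ x n, H (cyl x n) = ∑ i, H (cyl (Function.update x n i) (n+1)) := by
    intro x n
    rw [← hH2 _ (m x n + K) (fun i => hsat1 x _ n (hup x n i))]
    · congr 1
      ext z
      simp only [Set.mem_iUnion]
      constructor
      · rintro ⟨a, ha, rfl⟩
        refine ⟨a n, a, ?_, rfl⟩
        intro j hj
        by_cases hjn : j = n
        · subst hjn; simp
        · rw [Function.update_of_ne hjn]; exact ha j (by omega)
      · rintro ⟨i, a, ha, rfl⟩
        refine ⟨a, fun j hj => ?_, rfl⟩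
        rw [← show _ = a j from ha j (by omega), Function.update_of_ne (by omega)]
    · intro i j hij
      refine Set.disjoint_left.mpr ?_
      rintro _ ⟨a, ha, rfl⟩ ⟨b, hb, hab⟩
      have := g.injective hab
      subst this
      have h1 := ha n (by omega)
      have h2 := hb n (by omega)
      simp only [Function.update_self] at h1 h2
      exact hij (h1.trans h2.symm)
  have hWp : ∀ x n, 0 < W p x n := W_pos hp0
  have hWq : ∀ x n, 0 < W q x n := W_pos hq0
  have hWpD : ∀ x n, W p x n = W ρ x n ^ D := W_rpow hρ0 D
  have hWqD : ∀ x n, W q x n = W τ x n ^ D := W_rpow hτ0 D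
  -- bounds on theta
  obtain ⟨b, hb, hΘb⟩ : ∃ b, 0 < b ∧ ∀ θ ∈ Θ, b ≤ θ := by
    have : Finite Θ := hΘ
    have : Finite Θ := hΘ
    obtain ⟨b, hb, -, hb1⟩ := exists_low (ι := Θ) (ρ := fun t => t.1) (fun t => hΘ0 t.1 t.2)
    exact ⟨b, hb, fun t ht => hb1 ⟨t, ht⟩⟩
  obtain ⟨B, hΘB⟩ := hΘ.bddAbove
  have hΘB : ∀ θ ∈ Θ, θ ≤ B := fun θ h => hΘB h
  let h : (ℕ → ι) × ℕ → ℝ := fun s => H (cyl s.1 s.2) / W p s.1 s.2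
  obtain ⟨⟨x0, n0⟩, hx0⟩ := rig_abs (X := (ℕ → ι) × ℕ) p hp0
    (fun s i => (Function.update s.1 s.2 i, s.2+1)) h (c ^ D * b) (C ^ D * B) (by positivity) (by
      rintro ⟨x, n⟩
      obtain ⟨θ, hθ, hHθ⟩ := F0 x n
      change _ ≤ H (cyl x n) / W p x n
      rw [le_div_iff₀ (hWp _ _), hHθ, hWqD, hWpD]
      have h1 : (c * W ρ x n) ^ D ≤ W τ (g x) (m x n) ^ D :=
        Real.rpow_le_rpow (mul_nonneg hc.le (W_pos hρ0 _ _).le) (hm3 x n) hD.le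
      rw [Real.mul_rpow hc.le (W_pos hρ0 _ _).le] at h1
      calc _ = (c ^ D * W ρ x n ^ D) * b := by ring
        _ ≤ _ := mul_le_mul h1 (hΘb θ hθ) hb.le (Real.rpow_nonneg (W_pos hτ0 _ _).le _)) (by
      rintro ⟨x, n⟩
      obtain ⟨θ, hθ, hHθ⟩ := F0 x n
      change H (cyl x n) / W p x n ≤ _
      rw [div_le_iff₀ (hWp _ _), hHθ, hWqD, hWpD]
      have h1 : W τ (g x) (m x n) ^ D ≤ (C * W ρ x n) ^ D :=
        Real.rpow_le_rpow (W_pos hτ0 _ _).le (hm4 x n) hD.le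
      rw [Real.mul_rpow hC.le (W_pos hρ0 _ _).le] at h1
      calc _ ≤ (C ^ D * W ρ x n ^ D) * B := mul_le_mul h1 (hΘB θ hθ) (hΘ0 θ hθ).le
              (mul_nonneg (Real.rpow_nonneg hC.le _) (Real.rpow_nonneg (W_pos hρ0 _ _).le _))
        _ = _ := by ring) (by
      rintro ⟨x, n⟩
      change H (cyl x n) / W p x n = ∑ i, p i * (H (cyl (Function.update x n i) (n+1)) / W p (Function.update x n i) (n+1))
      rw [F2, Finset.sum_div]
      refine Finset.sum_congr rfl fun i _ => ?_
      rw [W_succ, ← W_congr p (hup x n i), Function.update_self]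
      have := hp0 i
      have := hWp x n
      field_simp)
    ((fun t : ℝ × ℝ × ι => t.1 / (t.2.1 * p t.2.2)) '' (Θ ×ˢ (Θ ×ˢ Set.univ)))
    ((hΘ.prod (hΘ.prod Set.finite_univ)).image _) (by
      rintro ⟨x, n⟩ i
      obtain ⟨θ, hθ, hHθ⟩ := F0 x n
      obtain ⟨θ', hθ', hHθ'⟩ := F1 x (Function.update x n i) n (hup x n i)
      refine ⟨(θ', θ, i), ⟨hθ', hθ, trivial⟩, ?_⟩
      change _ = (H (cyl (Function.update x n i) (n+1)) / W p (Function.update x n i) (n+1)) / (H (cyl x n) / W p x n)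
      rw [hHθ, hHθ', W_succ, ← W_congr p (hup x n i), Function.update_self]
      have := hp0 i
      have := hWp x n
      have := hWq (g x) (m x n)
      have := hΘ0 θ hθ
      simp only
      field_simp)
  have hh0 : 0 < h (x0, n0) := by
    obtain ⟨θ, hθ, hHθ⟩ := F0 x0 n0
    change 0 < H (cyl x0 n0) / W p x0 n0
    rw [hHθ]
    exact div_pos (mul_pos (hWq _ _) (hΘ0 θ hθ)) (hWp _ _)
  set h0 := h (x0, n0) with hh0d
  have hcong : ∀ x y n, Agree x y n → h (x, n) = h (y, n) := by
    intro x y n hxy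
    change H (cyl x n) / W p x n = H (cyl y n) / W p y n
    have : cyl x n = cyl y n := by
      change g '' _ = g '' _
      congr 1
      ext z
      exact ⟨fun hz i hi => (hxy i hi).symm.trans (hz i hi), fun hz i hi => (hxy i hi).trans (hz i hi)⟩
    rw [this, W_congr p hxy]
  have hconst : ∀ t y, Agree x0 y n0 → h (y, n0 + t) = h0 := by
    intro t
    induction t with
    | zero => intro y hy; exact (hcong _ _ _ hy).symm
    | succ t ih =>
      intro y hy
      have := hx0 (y, n0 + t) (y (n0+t)) (ih y hy)
      rw [← add_assoc]
      simpa using this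
  refine ⟨K, (fun θ => θ / h0) '' Θ, x0, n0, hΘ.image _, ?_, ?_⟩
  · rintro _ ⟨θ, hθ, rfl⟩
    exact div_pos (hΘ0 θ hθ) hh0
  · intro y n hy hn
    obtain ⟨t, rfl⟩ := Nat.exists_eq_add_of_le hn
    have h1 := hconst t y hy
    obtain ⟨θ, hθ, hHθ⟩ := F0 y (n0+t)
    refine ⟨m y (n0+t), _, ⟨θ, hθ, rfl⟩, ?_, ?_⟩
    · change H (cyl y (n0+t)) / W p y (n0+t) = h0 at h1
      rw [hHθ] at h1
      rw [← hWpD, ← hWqD]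
      have := hWp y (n0+t)
      field_simp at h1
      simp only
      field_simp
      linarith
    · intro z hz i hi
      exact hm2 y (n0+t) y z (fun _ _ => rfl) hz i (by omega)


lemma count_bound {ι κ : Type} [Fintype ι] [Fintype κ] (g : (ℕ → ι) → (ℕ → κ))
    (x0 : ℕ → ι) (n0 : ℕ) (w' : ι → ℝ) (w : κ → ℝ) (hw' : ∀ i, 0 < w' i) (hw : ∀ i, 0 < w i)
    (c : ℝ) (hc : 0 < c)
    (h : ∀ y n, Agree x0 y n0 → n0 ≤ n → ∃ M, c * W w' y n ≤ W w (g y) M ∧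
      ∀ z, Agree (g y) (g z) M → Agree y z n) (hlt : ∑ j, w j < 1) : ∑ i, w' i ≤ 1 := by
  classical
  set P := ∑ i, w' i with hP
  set Q := ∑ j, w j with hQ
  have hQ0 : 0 ≤ Q := Finset.sum_nonneg fun j _ => (hw j).le
  have hW0 := W_pos hw' x0 n0
  have key : ∀ L : ℕ, c * W w' x0 n0 * P ^ L ≤ 1 / (1 - Q) := by
    intro L
    have hh : ∀ u : Fin L → ι, ∃ M, c * W w' (glue x0 n0 u) (n0+L) ≤ W w (g (glue x0 n0 u)) M ∧
      ∀ z, Agree (g (glue x0 n0 u)) (g z) M → Agree (glue x0 n0 u) z (n0+L) :=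
      fun u => h _ _ (agree_glue x0 n0 u) (by omega)
    choose M hM1 hM2 using hh
    let Ψ : (Fin L → ι) → (Σ m : ℕ, (Fin m → κ)) := fun u => ⟨M u, fun i => g (glue x0 n0 u) i⟩
    have hΨ : Function.Injective Ψ := by
      intro u v huv
      have hMe : M u = M v := congrArg Sigma.fst huv
      have hag : Agree (g (glue x0 n0 u)) (g (glue x0 n0 v)) (M u) := by
        intro i hi
        have h2 : ∀ (s s' : Σ m : ℕ, (Fin m → κ)), s = s' → ∀ (hi : i < s.1) (hi' : i < s'.1),
            s.2 ⟨i, hi⟩ = s'.2 ⟨i, hi'⟩ := by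
          rintro s _ rfl _ _; rfl
        exact h2 _ _ huv hi (hi.trans_eq hMe)
      have := hM2 u _ hag
      funext i
      have h3 := this (n0+i) (by omega)
      rwa [glue_add, glue_add] at h3
    obtain ⟨N, hN⟩ : ∃ N, ∀ u, M u ≤ N := by
      obtain ⟨N, hN⟩ := (Set.finite_range M).bddAbove
      exact ⟨N, fun u => hN ⟨u, rfl⟩⟩
    let F : (Σ m : ℕ, (Fin m → κ)) → ℝ := fun s => ∏ i, w (s.2 i)
    calc c * W w' x0 n0 * P ^ L = ∑ u : Fin L → ι, c * W w' (glue x0 n0 u) (n0+L) := by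
          rw [hP, Fintype.sum_pow, Finset.mul_sum]
          exact Finset.sum_congr rfl fun u _ => by rw [W_glue]; ring
      _ ≤ ∑ u : Fin L → ι, F (Ψ u) := by
          refine Finset.sum_le_sum fun u _ => (hM1 u).trans (le_of_eq ?_)
          simp only [W, F, Ψ]
          rw [Finset.prod_range]
      _ = ∑ s ∈ Finset.univ.image Ψ, F s := by
          rw [Finset.sum_image fun _ _ _ _ h => hΨ h]
      _ ≤ ∑ s ∈ (Finset.range (N+1)).sigma (fun m => (Finset.univ : Finset (Fin m → κ))), F s := by
          apply Finset.sum_le_sum_of_subset_of_nonneg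
          · intro s hs
            obtain ⟨u, -, rfl⟩ := Finset.mem_image.mp hs
            simp only [Finset.mem_sigma, Finset.mem_range, Finset.mem_univ, and_true]
            exact Nat.lt_succ_of_le (hN u)
          · intro s _ _
            exact Finset.prod_nonneg fun i _ => (hw _).le
      _ = ∑ m ∈ Finset.range (N+1), Q ^ m := by
          rw [Finset.sum_sigma]
          exact Finset.sum_congr rfl fun m _ => by rw [hQ, Fintype.sum_pow]
      _ ≤ 1 / (1 - Q) := by
          rw [le_div_iff₀ (by linarith), geom_sum_mul_neg]
          have := pow_nonneg hQ0 (N+1)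
          linarith
  by_contra hgt
  push Not at hgt
  obtain ⟨L, hL⟩ := pow_unbounded_of_one_lt (1 / (1 - Q) / (c * W w' x0 n0)) hgt
  rw [div_lt_iff₀ (by positivity)] at hL
  have := key L
  linarith

/-- exponent vector -/
def X {s : ℕ} {a : Fin s → ℕ} (k : Fin s → ℕ) (y : ℕ → Σ j : Fin s, Fin (a j)) (n : ℕ) (j : Fin s) : ℕ :=
  ∑ i ∈ Finset.range n, if (y i).1 = j then k j else 0

lemma W_eq_prod {s : ℕ} {a : Fin s → ℕ} (k : Fin s → ℕ) (t : Fin s → ℝ)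
    (y : ℕ → Σ j : Fin s, Fin (a j)) (n : ℕ) :
    W (fun x : Σ j : Fin s, Fin (a j) => t x.1 ^ k x.1) y n = ∏ j, t j ^ X k y n j := by
  unfold W X
  have : ∀ j, t j ^ (∑ i ∈ Finset.range n, if (y i).1 = j then k j else 0) =
      ∏ i ∈ Finset.range n, t j ^ (if (y i).1 = j then k j else 0) := fun j =>
    (Finset.prod_pow_eq_pow_sum _ _ _).symm
  simp_rw [this]
  rw [Finset.prod_comm]
  refine Finset.prod_congr rfl fun i _ => ?_
  rw [Finset.prod_eq_single (y i).1]
  · simp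
  · intro j _ hj
    rw [if_neg hj.symm, pow_zero]
  · simp

lemma log_W {s : ℕ} {a : Fin s → ℕ} (k : Fin s → ℕ) (t : Fin s → ℝ) (ht : ∀ j, 0 < t j)
    (y : ℕ → Σ j : Fin s, Fin (a j)) (n : ℕ) :
    Real.log (W (fun x : Σ j : Fin s, Fin (a j) => t x.1 ^ k x.1) y n) =
      ∑ j, (X k y n j : ℝ) * Real.log (t j) := by
  rw [W_eq_prod, Real.log_prod (fun j _ => (pow_pos (ht j) _).ne')]
  simp [Real.log_pow]

lemma Lam_inj {s : ℕ} (v : Fin s → ℝ) (hind : LinearIndependent ℚ v) :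
    Function.Injective (fun z : Fin s → ℤ => ∑ j, (z j : ℝ) * v j) := by
  intro z z' h
  have h' : ∑ j, ((z j - z' j : ℤ) : ℚ) • v j = 0 := by
    simp only [Rat.smul_def]
    push_cast
    simp only [sub_mul, Finset.sum_sub_distrib]
    exact sub_eq_zero.mpr h
  have := Fintype.linearIndependent_iff.mp hind _ h'
  funext j
  have h2 := this j
  have h3 : z j - z' j = 0 := by exact_mod_cast h2
  omega

lemma main_incl {s : ℕ} (hs : 2 ≤ s) (lam : Fin s → ℝ)
    (hlam : ∀ i, lam i ∈ Set.Ioo (0 : ℝ) 1)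
    (hind : LinearIndependent ℚ fun i => Real.log (lam i))
    (a k b l : Fin s → ℕ)
    (ha : ∀ j, 0 < a j) (hk : ∀ j, 0 < k j) (hb : ∀ j, 0 < b j) (hl : ∀ j, 0 < l j)
    (g : (ℕ → Σ j : Fin s, Fin (a j)) ≃ (ℕ → Σ j : Fin s, Fin (b j)))
    (hg : SymBL (fun x : Σ j : Fin s, Fin (a j) => lam x.1 ^ k x.1)
      (fun x : Σ j : Fin s, Fin (b j) => lam x.1 ^ l x.1) g)
    (t : Fin s → ℝ) (ht : ∀ j, 0 < t j) (hlt : ∑ j, (b j : ℝ) * t j ^ l j < 1) :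
    ∑ j, (a j : ℝ) * t j ^ k j ≤ 1 := by
  classical
  have hρ : ∀ x : Σ j : Fin s, Fin (a j), lam x.1 ^ k x.1 ∈ Set.Ioo (0:ℝ) 1 := fun x =>
    ⟨pow_pos (hlam _).1 _, pow_lt_one₀ (hlam _).1.le (hlam _).2 (hk _).ne'⟩
  have hτ : ∀ x : Σ j : Fin s, Fin (b j), lam x.1 ^ l x.1 ∈ Set.Ioo (0:ℝ) 1 := fun x =>
    ⟨pow_pos (hlam _).1 _, pow_lt_one₀ (hlam _).1.le (hlam _).2 (hl _).ne'⟩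
  have hne : Nonempty (Σ j : Fin s, Fin (a j)) := ⟨⟨⟨0, by omega⟩, ⟨0, ha _⟩⟩⟩
  have hcard : 2 ≤ Fintype.card (Σ j : Fin s, Fin (b j)) := by
    simp only [Fintype.card_sigma, Fintype.card_fin]
    calc 2 ≤ s := hs
      _ = ∑ j : Fin s, 1 := by simp
      _ ≤ _ := Finset.sum_le_sum fun j _ => hb j
  obtain ⟨D, hD, hD1⟩ := exists_dim _ hτ hcard
  obtain ⟨K, Θ, x0, n0, hΘ, hΘ0, hrig⟩ := rigid hρ hτ hg D hD hD1
  have ht1 : ∀ j, t j < 1 := by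
    intro j
    by_contra hge
    push Not at hge
    have h1 : (b j : ℝ) * t j ^ l j ≤ ∑ j, (b j : ℝ) * t j ^ l j :=
      Finset.single_le_sum (f := fun j => (b j : ℝ) * t j ^ l j)
        (fun i _ => mul_nonneg (Nat.cast_nonneg _) (pow_pos (ht i) _).le) (Finset.mem_univ j)
    have h2 : (1:ℝ) ≤ b j := by exact_mod_cast hb j
    have h3 : 1 ≤ t j ^ l j := one_le_pow₀ hge
    nlinarith
  -- bounded discrepancy
  let Lam : (Fin s → ℤ) → ℝ := fun z => ∑ j, (z j : ℝ) * Real.log (lam j)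
  have hLam : Function.Injective Lam := Lam_inj _ hind
  let V : Set (Fin s → ℤ) := Lam ⁻¹' ((fun θ => Real.log θ / D) '' Θ)
  have hV : V.Finite := (hΘ.image _).preimage hLam.injOn
  obtain ⟨B, hB⟩ : ∃ B : ℕ, ∀ v ∈ V, ∀ j, - v j ≤ B := by
    have : (⋃ j, (fun v : Fin s → ℤ => (- v j).toNat) '' V).Finite :=
      Set.finite_iUnion fun j => hV.image _
    obtain ⟨B, hB⟩ := this.bddAbove
    refine ⟨B, fun v hv j => ?_⟩
    have := hB (Set.mem_iUnion.mpr ⟨j, v, hv, rfl⟩)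
    simp only at this
    omega
  have hw' : ∀ x : Σ j : Fin s, Fin (a j), 0 < t x.1 ^ k x.1 := fun x => pow_pos (ht _) _
  have hw : ∀ x : Σ j : Fin s, Fin (b j), 0 < t x.1 ^ l x.1 := fun x => pow_pos (ht _) _
  obtain ⟨r, hr0, hr1, hr⟩ := exists_low hw
  have hcb := count_bound g x0 n0 (fun x : Σ j : Fin s, Fin (a j) => t x.1 ^ k x.1)
    (fun x : Σ j : Fin s, Fin (b j) => t x.1 ^ l x.1) hw' hw ((∏ j, t j ^ B) * r ^ K)
    (mul_pos (Finset.prod_pos fun j _ => pow_pos (ht j) _) (pow_pos hr0 _)) (by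
      intro y n hy hn
      obtain ⟨m, θ, hθ, hWW, hag⟩ := hrig y n hy hn
      refine ⟨m + K, ?_, hag⟩
      have hl0 : ∀ j, 0 < lam j := fun j => (hlam j).1
      have hWρ := W_pos (fun j => (hρ j).1) y n
      have hWτ := W_pos (fun j => (hτ j).1) (g y) m
      have hlog := congrArg Real.log hWW
      rw [Real.log_mul (Real.rpow_pos_of_pos hWτ _).ne' (hΘ0 θ hθ).ne', Real.log_rpow hWρ,
        Real.log_rpow hWτ, log_W k lam hl0, log_W l lam hl0] at hlog
      have hmem : (fun j => (X k y n j : ℤ) - (X l (g y) m j : ℤ)) ∈ V := by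
        refine ⟨θ, hθ, ?_⟩
        simp only [Lam]
        push_cast
        simp only [sub_mul, Finset.sum_sub_distrib]
        field_simp
        linarith
      have hYX : ∀ j, X l (g y) m j ≤ X k y n j + B := by
        intro j
        have := hB _ hmem j
        omega
      refine le_trans ?_ (le_W_add hr0 hr (g y) m K)
      rw [W_eq_prod, W_eq_prod]
      have : (∏ j, t j ^ B) * ∏ j, t j ^ X k y n j ≤ ∏ j, t j ^ X l (g y) m j := by
        rw [← Finset.prod_mul_distrib]
        refine Finset.prod_le_prod (fun j _ => mul_nonneg (pow_pos (ht j) _).le (pow_pos (ht j) _).le) fun j _ => ?_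
        rw [← pow_add, add_comm]
        exact pow_le_pow_of_le_one (ht j).le (ht1 j).le (hYX j)
      calc _ = ((∏ j, t j ^ B) * ∏ j, t j ^ X k y n j) * r ^ K := by ring
        _ ≤ _ := by gcongr) (by
      rw [Fintype.sum_sigma]; simpa using hlt)
  rw [Fintype.sum_sigma] at hcb
  simpa using hcb

/-- inclusion extended to closed orthant and closed inequality -/
lemma incl_closed {s : ℕ} (a k b l : Fin s → ℕ) (hl : ∀ j, 0 < l j)
    (h : ∀ t : Fin s → ℝ, (∀ j, 0 < t j) → ∑ j, (b j : ℝ) * t j ^ l j < 1 →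
      ∑ j, (a j : ℝ) * t j ^ k j ≤ 1)
    (t : Fin s → ℝ) (ht : ∀ j, 0 ≤ t j) (hle : ∑ j, (b j : ℝ) * t j ^ l j ≤ 1) :
    ∑ j, (a j : ℝ) * t j ^ k j ≤ 1 := by
  have step1 : ∀ t : Fin s → ℝ, (∀ j, 0 ≤ t j) → ∑ j, (b j : ℝ) * t j ^ l j < 1 →
      ∑ j, (a j : ℝ) * t j ^ k j ≤ 1 := by
    intro t ht hlt
    have hc1 : Filter.Tendsto (fun ε : ℝ => ∑ j, (b j : ℝ) * (t j + ε) ^ l j) (nhdsWithin 0 (Set.Ioi 0))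
        (nhds (∑ j, (b j : ℝ) * (t j + 0) ^ l j)) :=
      (Continuous.tendsto (by fun_prop) 0).mono_left nhdsWithin_le_nhds
    have hc2 : Filter.Tendsto (fun ε : ℝ => ∑ j, (a j : ℝ) * (t j + ε) ^ k j) (nhdsWithin 0 (Set.Ioi 0))
        (nhds (∑ j, (a j : ℝ) * (t j + 0) ^ k j)) :=
      (Continuous.tendsto (by fun_prop) 0).mono_left nhdsWithin_le_nhds
    simp only [add_zero] at hc1 hc2
    refine le_of_tendsto hc2 ?_
    filter_upwards [hc1.eventually (gt_mem_nhds hlt), self_mem_nhdsWithin] with ε h1 h2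
    exact h _ (fun j => add_pos_of_nonneg_of_pos (ht j) h2) h1
  have hc2 : Filter.Tendsto (fun ε : ℝ => ∑ j, (a j : ℝ) * ((1 - ε) * t j) ^ k j) (nhdsWithin 0 (Set.Ioi 0))
      (nhds (∑ j, (a j : ℝ) * ((1 - 0) * t j) ^ k j)) :=
    (Continuous.tendsto (by fun_prop) 0).mono_left nhdsWithin_le_nhds
  simp only [sub_zero, one_mul] at hc2
  refine le_of_tendsto hc2 ?_
  filter_upwards [self_mem_nhdsWithin, nhdsWithin_le_nhds (gt_mem_nhds (show (0:ℝ) < 1 by norm_num))] with ε h1 h2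
  have h1 : 0 < ε := h1
  refine step1 _ (fun j => mul_nonneg (by linarith) (ht j)) ?_
  have : ∑ j, (b j : ℝ) * ((1 - ε) * t j) ^ l j ≤ (1 - ε) * ∑ j, (b j : ℝ) * t j ^ l j := by
    rw [Finset.mul_sum]
    refine Finset.sum_le_sum fun j _ => ?_
    rw [mul_pow]
    have h3 : (1 - ε) ^ l j ≤ 1 - ε := pow_le_of_le_one (by linarith) (by linarith) (hl j).ne'
    have h4 : 0 ≤ (b j : ℝ) * t j ^ l j := mul_nonneg (Nat.cast_nonneg _) (pow_nonneg (ht j) _)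
    nlinarith
  nlinarith

lemma sum_single {s : ℕ} (a k : Fin s → ℕ) (hk : ∀ j, 0 < k j) (i : Fin s) (r : ℝ) :
    ∑ j, (a j : ℝ) * (Pi.single i r : Fin s → ℝ) j ^ k j = a i * r ^ k i := by
  rw [Finset.sum_eq_single i]
  · simp
  · intro j _ hj
    simp [hj, (hk j).ne']
  · simp

lemma sum_two {s : ℕ} (a k : Fin s → ℕ) (hk : ∀ j, 0 < k j) (i i' : Fin s) (hi : i ≠ i') (r r' : ℝ) :
    ∑ j, (a j : ℝ) * (Pi.single i r + Pi.single i' r' : Fin s → ℝ) j ^ k j =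
      a i * r ^ k i + a i' * r' ^ k i' := by
  rw [Finset.sum_eq_add i i' hi]
  · simp [hi, hi.symm]
  · intro j _ hj
    simp [hj.1, hj.2, (hk j).ne']
  · simp
  · simp

lemma root {a k : ℕ} (ha : 0 < a) (hk : 0 < k) : ∃ r : ℝ, 0 < r ∧ (a : ℝ) * r ^ k = 1 := by
  have ha' : (0:ℝ) < a := by exact_mod_cast ha
  refine ⟨((a:ℝ)⁻¹) ^ ((k:ℝ)⁻¹), Real.rpow_pos_of_pos (by positivity) _, ?_⟩
  rw [Real.rpow_inv_natCast_pow (by positivity) hk.ne', mul_inv_cancel₀ ha'.ne']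

lemma root_le {s : ℕ} {a k b l : Fin s → ℕ} (ha : ∀ j, 0 < a j) (hk : ∀ j, 0 < k j)
    (hl : ∀ j, 0 < l j)
    (h : ∀ t : Fin s → ℝ, (∀ j, 0 ≤ t j) → ∑ j, (b j : ℝ) * t j ^ l j ≤ 1 →
      ∑ j, (a j : ℝ) * t j ^ k j ≤ 1) (i : Fin s) (r r' : ℝ) (hr : 0 < r) (hr' : 0 < r')
    (h1 : (a i : ℝ) * r ^ k i = 1) (h2 : (b i : ℝ) * r' ^ l i = 1) : r' ≤ r := by
  have := h (Pi.single i r') (fun j => by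
    by_cases hj : j = i
    · subst hj; simpa using hr'.le
    · simp [hj]) (by rw [sum_single _ _ hl, h2])
  rw [sum_single _ _ hk, ← h1] at this
  have ha' : (0:ℝ) < a i := by exact_mod_cast ha i
  have := le_of_mul_le_mul_left this ha'
  exact le_of_pow_le_pow_left₀ (hk i).ne' hr.le this

lemma exp_le {s : ℕ} {a k b l : Fin s → ℕ} (hk : ∀ j, 0 < k j) (hl : ∀ j, 0 < l j)
    (h : ∀ t : Fin s → ℝ, (∀ j, 0 ≤ t j) → ∑ j, (b j : ℝ) * t j ^ l j ≤ 1 →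
      ∑ j, (a j : ℝ) * t j ^ k j ≤ 1) (r : Fin s → ℝ) (hr : ∀ i, 0 < r i)
    (h1 : ∀ i, (a i : ℝ) * r i ^ k i = 1) (h2 : ∀ i, (b i : ℝ) * r i ^ l i = 1)
    (i i' : Fin s) (hii : i ≠ i') : l i ≤ k i := by
  by_contra hlt
  push Not at hlt
  have hk1 : (1:ℝ) ≤ k i' := by exact_mod_cast hk i'
  set x : ℝ := 1 / (2 * k i') with hx
  have hx0 : 0 < x := by positivity
  have hx1 : x ≤ 1 := by rw [hx, div_le_one (by positivity)]; linarith
  set y := x ^ l i with hy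
  have hy0 : 0 ≤ y := by positivity
  have hy1 : y ≤ 1 := pow_le_one₀ hx0.le hx1
  have := h (Pi.single i (r i * x) + Pi.single i' (r i' * (1 - y))) (fun j => by
    have e1 : 0 ≤ r i * x := mul_nonneg (hr i).le hx0.le
    have e2 : 0 ≤ r i' * (1 - y) := mul_nonneg (hr i').le (by linarith)
    have e3 : (0 : Fin s → ℝ) ≤ Pi.single i (r i * x) + Pi.single i' (r i' * (1 - y)) :=
      add_nonneg (Pi.single_nonneg.mpr e1) (Pi.single_nonneg.mpr e2)
    exact e3 j) (by
      rw [sum_two _ _ hl _ _ hii, mul_pow, mul_pow, ← mul_assoc, ← mul_assoc, h2, h2]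
      have := pow_le_of_le_one (show 0 ≤ 1 - y by linarith) (by linarith) (hl i').ne'
      linarith)
  rw [sum_two _ _ hk _ _ hii, mul_pow, mul_pow, ← mul_assoc, ← mul_assoc, h1, h1, one_mul, one_mul] at this
  have hbern := one_add_mul_le_pow (show (-2:ℝ) ≤ -y by linarith) (k i')
  have e : 1 + -y = 1 - y := by ring
  rw [e] at hbern
  have h3 : x ^ k i ≤ k i' * y := by nlinarith
  have h4 : y ≤ x ^ k i * x := by
    rw [hy, ← pow_succ]
    exact pow_le_pow_of_le_one hx0.le hx1 hlt
  have h5 : 0 < x ^ k i := by positivity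
  have h6 : (k i' : ℝ) * y ≤ k i' * (x ^ k i * x) := by gcongr
  have h7 : (k i' : ℝ) * (x ^ k i * x) = x ^ k i / 2 := by
    have : (k i' : ℝ) ≠ 0 := by positivity
    rw [hx]; field_simp
  linarith

lemma exists_equiv_of_map_eq {ι κ : Type} [Fintype ι] [Fintype κ] (f : ι → ℝ) (f' : κ → ℝ)
    (h : Finset.univ.val.map f = Finset.univ.val.map f') : ∃ e : ι ≃ κ, f' ∘ e = f := by
  classical
  have hc : ∀ r, Fintype.card {x // f x = r} = Fintype.card {x // f' x = r} := by
    intro r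
    have := congrArg (Multiset.count r) h
    rw [Multiset.count_map, Multiset.count_map] at this
    rw [Fintype.card_subtype, Fintype.card_subtype]
    simpa [Finset.card_def, eq_comm] using this
  have e : ∀ r, {x // f x = r} ≃ {x // f' x = r} := fun r => Fintype.equivOfCardEq (hc r)
  refine ⟨(Equiv.sigmaFiberEquiv f).symm.trans ((Equiv.sigmaCongrRight e).trans (Equiv.sigmaFiberEquiv f')), ?_⟩
  funext x
  exact (e (f x) ⟨x, rfl⟩).2

lemma dustLike_reindex {d : ℕ} {ι κ : Type} [Fintype ι] [Fintype κ] (e : ι ≃ κ)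
    {F : Set (EuclideanSpace ℝ (Fin d))} {τ : κ → ℝ} (h : IsDustLike F τ) : IsDustLike F (τ ∘ e) := by
  obtain ⟨h1, h2, h3, φ, h4, h5, h6⟩ := h
  refine ⟨h1, h2, fun j => h3 _, fun j => φ (e j), fun j => h4 _, ?_, fun i j hij => h6 (e.injective.ne hij)⟩
  rw [e.surjective.iUnion_comp (fun j => φ j '' F)]
  exact h5

end DL

theorem stmt10 {d d' s : ℕ} (hs : 2 ≤ s) (lam : Fin s → ℝ)
    (hlam : ∀ i, lam i ∈ Set.Ioo (0 : ℝ) 1)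
    (hind : LinearIndependent ℚ fun i => Real.log (lam i))
    (a k b l : Fin s → ℕ)
    (ha : ∀ j, 0 < a j) (hk : ∀ j, 0 < k j) (hb : ∀ j, 0 < b j) (hl : ∀ j, 0 < l j)
    (E : Set (EuclideanSpace ℝ (Fin d))) (F : Set (EuclideanSpace ℝ (Fin d')))
    (hE : IsDustLike E fun x : Σ j : Fin s, Fin (a j) => lam x.1 ^ k x.1)
    (hF : IsDustLike F fun x : Σ j : Fin s, Fin (b j) => lam x.1 ^ l x.1) :
    LipEquiv E F ↔
      Finset.univ.val.map (fun x : Σ j : Fin s, Fin (a j) => lam x.1 ^ k x.1) =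
        Finset.univ.val.map (fun x : Σ j : Fin s, Fin (b j) => lam x.1 ^ l x.1) := by
  classical
  constructor
  · intro h
    obtain ⟨g, hg⟩ := DL.symBL_of_lipEquiv hE hF h
    have i1 := DL.incl_closed a k b l hl
      (DL.main_incl hs lam hlam hind a k b l ha hk hb hl g hg)
    have i2 := DL.incl_closed b l a k hk
      (DL.main_incl hs lam hlam hind b l a k hb hl ha hk g.symm hg.symm)
    choose r hr0 hr using fun i => DL.root (ha i) (hk i)
    choose r' hr0' hr' using fun i => DL.root (hb i) (hl i)
    have hrr : r' = r := by
      funext i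
      exact le_antisymm (DL.root_le ha hk hl i1 i _ _ (hr0 i) (hr0' i) (hr i) (hr' i))
        (DL.root_le hb hl hk i2 i _ _ (hr0' i) (hr0 i) (hr' i) (hr i))
    subst hrr
    have hkl : k = l := by
      funext i
      obtain ⟨i', hi'⟩ : ∃ i' : Fin s, i ≠ i' := by
        have : Nontrivial (Fin s) := Fin.nontrivial_iff_two_le.mpr hs
        obtain ⟨j, hj⟩ := exists_ne i
        exact ⟨j, hj.symm⟩
      exact le_antisymm (DL.exp_le hl hk i2 r' hr0' hr' hr i i' hi')
        (DL.exp_le hk hl i1 r' hr0' hr hr' i i' hi')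
    subst hkl
    have hab : a = b := by
      funext i
      have h1 := (hr i).trans (hr' i).symm
      have h2 := mul_right_cancel₀ (pow_pos (hr0' i) (k i)).ne' h1
      exact_mod_cast h2
    subst hab
    rfl
  · intro h
    obtain ⟨e, he⟩ := DL.exists_equiv_of_map_eq _ _ h
    have hF' := DL.dustLike_reindex e hF
    rw [he] at hF'
    exact DL.lipEquiv_of_same hE hF'
end
end

section
/- Let s ≥ 2 and let a_1,…,a_s, b_1,…,b_s, p, q be positive integers such that a_j^p = b_j^q for every j = 1,…,s and (a_1 + ⋯ + a_s)^p = (b_1 + ⋯ + b_s)^q. Then p = q and a_j = b_j for every j. -/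
theorem stmt11_aux {s : ℕ} (hs : 2 ≤ s) (a b : Fin s → ℕ) (p q : ℕ)
    (ha : ∀ j, 0 < a j) (hq : 0 < q)
    (h1 : ∀ j, a j ^ p = b j ^ q)
    (h2 : (∑ j, a j) ^ p = (∑ j, b j) ^ q) (hlt : q < p) : False := by
  have hS : ∀ j, a j < ∑ i, a i := by
    intro j
    haveI : Nontrivial (Fin s) := Fin.nontrivial_iff_two_le.mpr hs
    obtain ⟨k, hk⟩ := exists_ne j
    exact Finset.single_lt_sum hk (Finset.mem_univ _) (Finset.mem_univ _) (ha k)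
      (fun _ _ _ => Nat.zero_le _)
  have key : ∀ j, b j * (∑ i, a i) < a j * (∑ i, b i) := by
    intro j
    apply lt_of_pow_lt_pow_left₀ q (Nat.zero_le _)
    rw [mul_pow, mul_pow, ← h1, ← h2]
    obtain ⟨d, rfl⟩ := Nat.exists_eq_add_of_lt hlt
    have h := Nat.pow_lt_pow_left (hS j) (Nat.succ_ne_zero d)
    have hpos : 0 < a j ^ q * (∑ i, a i) ^ q :=
      Nat.mul_pos (Nat.pow_pos (ha j)) (Nat.pow_pos ((ha j).trans (hS j)))
    calc a j ^ (q + d + 1) * (∑ i, a i) ^ q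
        = (a j ^ q * (∑ i, a i) ^ q) * a j ^ (d + 1) := by ring
      _ < (a j ^ q * (∑ i, a i) ^ q) * (∑ i, a i) ^ (d + 1) := Nat.mul_lt_mul_of_pos_left h hpos
      _ = _ := by ring
  have := Finset.sum_lt_sum_of_nonempty (s := (Finset.univ : Finset (Fin s)))
    ⟨⟨0, by omega⟩, Finset.mem_univ _⟩ (fun j _ => key j)
  rw [← Finset.sum_mul, ← Finset.sum_mul, mul_comm] at this
  exact lt_irrefl _ this

theorem stmt11 {s : ℕ} (hs : 2 ≤ s) (a b : Fin s → ℕ) (p q : ℕ)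
    (ha : ∀ j, 0 < a j) (hb : ∀ j, 0 < b j) (hp : 0 < p) (hq : 0 < q)
    (h1 : ∀ j, a j ^ p = b j ^ q)
    (h2 : (∑ j, a j) ^ p = (∑ j, b j) ^ q) :
    p = q ∧ ∀ j, a j = b j := by
  have hpq : p = q := by
    rcases lt_trichotomy p q with h | h | h
    · exact (stmt11_aux hs b a q p hb hp (fun j => (h1 j).symm) h2.symm h).elim
    · exact h
    · exact (stmt11_aux hs a b p q ha hq h1 h2 h).elim
  subst hpq
  exact ⟨rfl, fun j => Nat.pow_left_injective hp.ne' (h1 j)⟩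
end
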